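/- arXiv:1110.3157 — 4 statements merged into one kernel-verified Lean document; each statement's English description precedes it below -/
import Mathlib

section
/- Let p, q ∈ ℝ² with q ≠ 0 and p·q = 0. Then for every N > 0 the complex-valued function ξ ↦ (‖ξ‖² + 2 p·ξ + 2i q·ξ)⁻¹ is Lebesgue integrable on the disc {ξ ∈ ℝ² : ‖ξ‖ ≤ N}, and there exist constants C > 0 and N₀ > 0 such that for all N ≥ N₀: |∫_{‖ξ‖≤N} (‖ξ‖² + 2 p·ξ + 2i q·ξ)⁻¹ dξ − 2π ln N + 2π ln(|p| + |q|)| ≤ C/N. In other words, the truncated integral equals 2π ln(N/(|p|+|q|)) + O(N⁻¹) as N → ∞. -/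
open MeasureTheory Real

lemma fad_abs_rpow (r : ℝ) (hr : -1 < r) (M : ℝ) :
    IntegrableOn (fun x : ℝ => |x| ^ r) (Set.Ioc (-M) M) := by
  rcases le_or_gt M 0 with h | h
  · rw [Set.Ioc_eq_empty (by linarith)]; exact integrableOn_empty
  rw [← intervalIntegrable_iff_integrableOn_Ioc_of_le (by linarith)]
  have h1 : IntervalIntegrable (fun x : ℝ => |x| ^ r) volume 0 M := by
    refine (intervalIntegral.intervalIntegrable_rpow' hr).congr ?_
    intro x hx
    rw [Set.uIoc_of_le h.le] at hx
    simp only [abs_of_pos hx.1]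
  have h2 : IntervalIntegrable (fun x : ℝ => |x| ^ r) volume (-M) 0 := by
    have := (IntervalIntegrable.iff_comp_neg (f := fun x : ℝ => |x| ^ r)).1 h1
    simpa using this.symm
  exact h2.trans h1

lemma fad_abs_rpow_shift (r : ℝ) (hr : -1 < r) (M c : ℝ) :
    IntegrableOn (fun x : ℝ => |x + c| ^ r) (Set.Ioc (-M) M) := by
  have h := fad_abs_rpow r hr (|M| + |c|)
  have h3 := (measurePreserving_add_right volume c).integrableOn_comp_preimage
    (measurableEmbedding_addRight c) |>.2 h
  refine h3.mono_set ?_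
  intro x hx
  simp only [Set.mem_preimage, Set.mem_Ioc] at *
  have := neg_abs_le c; have := le_abs_self c; have := le_abs_self M
  constructor <;> linarith

lemma fad_bound (a b N x y : ℝ) (hb : 0 < b) (hN : 0 < N) (hx : x ≠ 0) (hx2 : x + 2 * a ≠ 0)
    (hy : y ≠ 0) (hyN : |y| ≤ N) :
    ‖(((x ^ 2 + y ^ 2 + 2 * (a * x) : ℝ) : ℂ) + 2 * Complex.I * ((b * y : ℝ) : ℂ))⁻¹‖ ≤
      ((1 + N / (2 * b)) ^ (1 / 4 : ℝ) * (2 * b) ^ (-3 / 4 : ℝ)) *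
        ((|x| ^ (-1 / 2 : ℝ) + |x + 2 * a| ^ (-1 / 2 : ℝ)) * |y| ^ (-3 / 4 : ℝ)) := by
  set w : ℂ := ((x ^ 2 + y ^ 2 + 2 * (a * x) : ℝ) : ℂ) + 2 * Complex.I * ((b * y : ℝ) : ℂ) with hw
  have hre : w.re = x ^ 2 + y ^ 2 + 2 * (a * x) := by simp [hw, -Complex.ofReal_pow]
  have him : w.im = 2 * (b * y) := by simp [hw, -Complex.ofReal_pow]
  have h1 : |x ^ 2 + y ^ 2 + 2 * (a * x)| ≤ ‖w‖ := by rw [← hre]; exact Complex.abs_re_le_norm w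
  have h2 : 2 * b * |y| ≤ ‖w‖ := by
    have := Complex.abs_im_le_norm w
    rw [him, abs_mul, abs_mul, abs_of_pos hb] at this
    norm_num at this; linarith
  have hy0 : 0 < |y| := abs_pos.2 hy
  have hD : 0 < ‖w‖ := lt_of_lt_of_le (by positivity) h2
  set k := 1 + N / (2 * b) with hk
  have hk0 : 0 < k := by positivity
  have h3 : |x| * |x + 2 * a| ≤ k * ‖w‖ := by
    have e : x * (x + 2 * a) = (x ^ 2 + y ^ 2 + 2 * (a * x)) - y ^ 2 := by ring
    rw [← abs_mul, e]
    have : y ^ 2 ≤ N / (2 * b) * ‖w‖ := by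
      calc y ^ 2 = |y| * |y| := by rw [← sq, sq_abs]
        _ ≤ N * |y| := by gcongr
        _ = N / (2 * b) * (2 * b * |y|) := by field_simp
        _ ≤ _ := by gcongr
    calc _ ≤ |x ^ 2 + y ^ 2 + 2 * (a * x)| + |y ^ 2| := abs_sub _ _
      _ ≤ ‖w‖ + N / (2 * b) * ‖w‖ := by rw [abs_of_nonneg (sq_nonneg y)]; gcongr
      _ = _ := by rw [hk]; ring
  have key : ∀ m : ℝ, 0 < m → m ^ 2 ≤ k * ‖w‖ → ‖w‖⁻¹ ≤
      (k ^ (1 / 4 : ℝ) * (2 * b) ^ (-3 / 4 : ℝ)) * (m ^ (-1 / 2 : ℝ) * |y| ^ (-3 / 4 : ℝ)) := by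
    intro m hm hmk
    have e1 : ‖w‖⁻¹ = ‖w‖ ^ (-1 / 4 : ℝ) * ‖w‖ ^ (-3 / 4 : ℝ) := by
      rw [← Real.rpow_add hD, ← Real.rpow_neg_one]; norm_num
    have e2 : ‖w‖ ^ (-3 / 4 : ℝ) ≤ (2 * b) ^ (-3 / 4 : ℝ) * |y| ^ (-3 / 4 : ℝ) := by
      rw [← Real.mul_rpow (by positivity) hy0.le]
      exact Real.rpow_le_rpow_of_nonpos (by positivity) h2 (by norm_num)
    have e3 : ‖w‖ ^ (-1 / 4 : ℝ) ≤ k ^ (1 / 4 : ℝ) * m ^ (-1 / 2 : ℝ) := by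
      have : m ^ 2 / k ≤ ‖w‖ := by rw [div_le_iff₀ hk0]; linarith
      refine (Real.rpow_le_rpow_of_nonpos (by positivity) this (by norm_num)).trans (le_of_eq ?_)
      rw [Real.div_rpow (by positivity) hk0.le, ← Real.rpow_natCast, ← Real.rpow_mul hm.le,
        div_eq_mul_inv, ← Real.rpow_neg hk0.le, mul_comm]
      norm_num
    rw [e1]
    calc _ ≤ (k ^ (1 / 4 : ℝ) * m ^ (-1 / 2 : ℝ)) * ((2 * b) ^ (-3 / 4 : ℝ) * |y| ^ (-3 / 4 : ℝ)) := by
          gcongr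
      _ = _ := by ring
  rw [norm_inv]
  have hx0 := abs_pos.2 hx
  have hx20 := abs_pos.2 hx2
  rcases le_total |x| |x + 2 * a| with h | h
  · refine (key |x| hx0 (by nlinarith)).trans ?_
    gcongr
    have : 0 ≤ |x + 2 * a| ^ (-1 / 2 : ℝ) := by positivity
    linarith
  · refine (key |x + 2 * a| hx20 (by nlinarith)).trans ?_
    gcongr
    have : 0 ≤ |x| ^ (-1 / 2 : ℝ) := by positivity
    linarith

/-- symbol in adapted coordinates -/
noncomputable def fadF (a b : ℝ) (z : ℂ) : ℂ :=
  (((‖z‖ ^ 2 + 2 * (a * z.re) : ℝ) : ℂ) + 2 * Complex.I * ((b * z.im : ℝ) : ℂ))⁻¹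

lemma fadF_meas (a b : ℝ) : Measurable (fadF a b) := by
  unfold fadF; fun_prop

lemma fad_integrableOn (a b N : ℝ) (hb : 0 < b) (hN : 0 < N) :
    IntegrableOn (fadF a b) (Metric.closedBall 0 N) := by
  have hM : 0 < 2 * N := by linarith
  have hbox : IntegrableOn (fun v : ℝ × ℝ => fadF a b (Complex.measurableEquivRealProd.symm v))
      (Set.Ioc (-(2 * N)) (2 * N) ×ˢ Set.Ioc (-(2 * N)) (2 * N)) := by
    have hg : IntegrableOn (fun v : ℝ × ℝ =>
        ((1 + (2 * N) / (2 * b)) ^ (1 / 4 : ℝ) * (2 * b) ^ (-3 / 4 : ℝ)) *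
        ((|v.1| ^ (-1 / 2 : ℝ) + |v.1 + 2 * a| ^ (-1 / 2 : ℝ)) * |v.2| ^ (-3 / 4 : ℝ)))
      (Set.Ioc (-(2 * N)) (2 * N) ×ˢ Set.Ioc (-(2 * N)) (2 * N)) := by
      have h1 := (fad_abs_rpow (-1 / 2) (by norm_num) (2 * N)).add
        (fad_abs_rpow_shift (-1 / 2) (by norm_num) (2 * N) (2 * a))
      have h2 := fad_abs_rpow (-3 / 4) (by norm_num) (2 * N)
      have h3 := Integrable.mul_prod h1 h2
      rw [Measure.prod_restrict] at h3
      exact Integrable.const_mul h3 _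
    refine Integrable.mono' hg ?_ ?_
    · exact ((fadF_meas a b).comp Complex.measurableEquivRealProd.symm.measurable).aestronglyMeasurable
    · have n1 : ∀ᵐ v : ℝ × ℝ, v.1 ≠ 0 := by
        rw [Measure.volume_eq_prod]
        exact Measure.quasiMeasurePreserving_fst.ae (Measure.ae_ne volume 0)
      have n2 : ∀ᵐ v : ℝ × ℝ, v.1 ≠ - (2 * a) := by
        rw [Measure.volume_eq_prod]
        exact Measure.quasiMeasurePreserving_fst.ae (Measure.ae_ne volume _)
      have n3 : ∀ᵐ v : ℝ × ℝ, v.2 ≠ 0 := by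
        rw [Measure.volume_eq_prod]
        exact Measure.quasiMeasurePreserving_snd.ae (Measure.ae_ne volume 0)
      filter_upwards [ae_restrict_of_ae n1, ae_restrict_of_ae n2, ae_restrict_of_ae n3,
        ae_restrict_mem (measurableSet_Ioc.prod measurableSet_Ioc)] with v m1 m2 m3 m4
      have := fad_bound a b (2 * N) v.1 v.2 hb hM m1 (fun h => m2 (by linarith)) m3
        (abs_le.2 ⟨m4.2.1.le, m4.2.2⟩)
      refine le_trans (le_of_eq ?_) this
      simp only [fadF, Complex.measurableEquivRealProd_symm_apply]
      rw [← Complex.normSq_eq_norm_sq, Complex.normSq_mk]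
      simp only [sq]
  have hc := Complex.volume_preserving_equiv_real_prod.integrableOn_comp_preimage
    Complex.measurableEquivRealProd.measurableEmbedding |>.2 hbox
  have : (fun v : ℝ × ℝ => fadF a b (Complex.measurableEquivRealProd.symm v)) ∘
      Complex.measurableEquivRealProd = fadF a b := by
    funext z; simp
  rw [this] at hc
  refine hc.mono_set ?_
  intro z hz
  have hz' : ‖z‖ ≤ N := by simpa using hz
  have r := abs_le.1 ((Complex.abs_re_le_norm z).trans hz')
  have i := abs_le.1 ((Complex.abs_im_le_norm z).trans hz')
  simp only [Set.mem_preimage, Set.mem_prod, Set.mem_Ioc, Complex.measurableEquivRealProd_apply]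
  refine ⟨⟨?_, ?_⟩, ⟨?_, ?_⟩⟩ <;> linarith

/-- angular part -/
noncomputable def fadW (a b θ : ℝ) : ℂ :=
  ((2 * (a * Real.cos θ) : ℝ) : ℂ) + ((2 * (b * Real.sin θ) : ℝ) : ℂ) * Complex.I

lemma fadW_re (a b θ : ℝ) : (fadW a b θ).re = 2 * (a * Real.cos θ) := by
  rw [fadW, Complex.add_re, Complex.re_ofReal_mul, Complex.ofReal_re, Complex.I_re]; ring

lemma fadW_im (a b θ : ℝ) : (fadW a b θ).im = 2 * (b * Real.sin θ) := by
  rw [fadW, Complex.add_im, Complex.im_ofReal_mul, Complex.ofReal_im, Complex.I_im]; ring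

lemma fadW_cont (a b : ℝ) : Continuous (fadW a b) := by
  unfold fadW; fun_prop

lemma fadF_polar (a b r θ : ℝ) (hr : 0 < r) :
    r • fadF a b (Complex.polarCoord.symm (r, θ)) = ((r : ℂ) + fadW a b θ)⁻¹ := by
  have h1 : ‖Complex.polarCoord.symm (r, θ)‖ = r := by
    rw [Complex.norm_polarCoord_symm, abs_of_pos hr]
  have h2 : (Complex.polarCoord.symm (r, θ)).re = r * Real.cos θ := by
    rw [Complex.polarCoord_symm_apply]; simp [-Complex.ofReal_cos, -Complex.ofReal_sin]
  have h3 : (Complex.polarCoord.symm (r, θ)).im = r * Real.sin θ := by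
    rw [Complex.polarCoord_symm_apply]; simp [-Complex.ofReal_cos, -Complex.ofReal_sin]
  rw [fadF, h1, h2, h3]
  have h4 : (((r ^ 2 + 2 * (a * (r * Real.cos θ)) : ℝ) : ℂ) +
      2 * Complex.I * ((b * (r * Real.sin θ) : ℝ) : ℂ)) = r * ((r : ℂ) + fadW a b θ) := by
    rw [fadW]; push_cast; ring
  have hr' : (r : ℂ) ≠ 0 := by exact_mod_cast hr.ne'
  rw [h4, Complex.real_smul, mul_inv, ← mul_assoc, mul_inv_cancel₀ hr', one_mul]

lemma fad_polar (a b N : ℝ) (hb : 0 < b) (hN : 0 < N) :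
    IntegrableOn (fun v : ℝ × ℝ => ((v.1 : ℂ) + fadW a b v.2)⁻¹)
      (Set.Ioc 0 N ×ˢ Set.Ioo (-π) π) ∧
    ∫ z in Metric.closedBall (0 : ℂ) N, fadF a b z =
      ∫ v in Set.Ioc 0 N ×ˢ Set.Ioo (-π) π, ((v.1 : ℂ) + fadW a b v.2)⁻¹ := by
  set h : ℂ → ℂ := (Metric.closedBall (0 : ℂ) N).indicator (fadF a b) with hh
  have hmeas : Measurable h := (fadF_meas a b).indicator Metric.isClosed_closedBall.measurableSet
  have hint : Integrable h :=
    (integrable_indicator_iff Metric.isClosed_closedBall.measurableSet).2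
      (fad_integrableOn a b N hb hN)
  have hSm : MeasurableSet (Set.Ioc 0 N ×ˢ Set.Ioo (-π) π) := measurableSet_Ioc.prod measurableSet_Ioo
  have hsub : (Set.Ioc 0 N ×ˢ Set.Ioo (-π) π) ⊆ Complex.polarCoord.target := by
    rw [Complex.polarCoord_target]
    exact Set.prod_mono (fun x hx => hx.1) le_rfl
  have hpm : Measurable (fun v : ℝ × ℝ => v.1 • h (Complex.polarCoord.symm v)) := by
    have : Measurable (fun v : ℝ × ℝ => Complex.polarCoord.symm v) := by
      simp only [Complex.polarCoord_symm_apply]; fun_prop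
    exact measurable_fst.smul (hmeas.comp this)
  have hP : IntegrableOn (fun v : ℝ × ℝ => v.1 • h (Complex.polarCoord.symm v))
      Complex.polarCoord.target := by
    refine ⟨hpm.aestronglyMeasurable, ?_⟩
    have := Complex.lintegral_comp_polarCoord_symm (fun z => ‖h z‖ₑ)
    have h2 := hint.2
    unfold HasFiniteIntegral at h2 ⊢
    rw [← this] at h2
    refine lt_of_le_of_lt (le_of_eq ?_) h2
    refine setLIntegral_congr_fun (Complex.polarCoord.open_target.measurableSet) ?_
    intro v hv
    rw [Complex.polarCoord_target] at hv
    simp only [enorm_smul, smul_eq_mul]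
    rw [Real.enorm_of_nonneg (le_of_lt hv.1)]
  have hin : ∀ v ∈ (Set.Ioc 0 N ×ˢ Set.Ioo (-π) π), v.1 • h (Complex.polarCoord.symm v) =
      ((v.1 : ℂ) + fadW a b v.2)⁻¹ := by
    rintro ⟨r, θ⟩ hv
    have hr : 0 < r := hv.1.1
    rw [← fadF_polar a b r θ hr, hh, Set.indicator_of_mem]
    rw [mem_closedBall_zero_iff, Complex.norm_polarCoord_symm, abs_of_pos hr]
    exact hv.1.2
  have hout : ∀ v ∈ Complex.polarCoord.target \ (Set.Ioc 0 N ×ˢ Set.Ioo (-π) π),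
      v.1 • h (Complex.polarCoord.symm v) = 0 := by
    rintro ⟨r, θ⟩ ⟨hv, hv2⟩
    rw [Complex.polarCoord_target] at hv
    have hr : 0 < r := hv.1
    rw [hh, Set.indicator_of_notMem, smul_zero]
    rw [mem_closedBall_zero_iff, Complex.norm_polarCoord_symm, abs_of_pos hr]
    intro hle
    exact hv2 ⟨⟨hr, hle⟩, hv.2⟩
  refine ⟨(hP.mono_set hsub).congr_fun hin hSm, ?_⟩
  rw [← integral_indicator Metric.isClosed_closedBall.measurableSet, ← hh,
    ← Complex.integral_comp_polarCoord_symm]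
  change ∫ v in Complex.polarCoord.target, _ = _
  rw [setIntegral_eq_of_subset_of_forall_sdiff_eq_zero
    Complex.polarCoord.open_target.measurableSet hsub hout]
  exact setIntegral_congr_fun hSm hin

lemma fad_inner (w : ℂ) (N : ℝ) (hN : 0 < N) (hw : w.im ≠ 0) :
    ∫ r in Set.Ioc 0 N, ((r : ℂ) + w)⁻¹ = Complex.log (N + w) - Complex.log w := by
  rw [← intervalIntegral.integral_of_le hN.le]
  have hs : ∀ r : ℝ, (r : ℂ) + w ∈ Complex.slitPlane := fun r =>
    Complex.mem_slitPlane_iff.2 (Or.inr (by simpa using hw))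
  rw [intervalIntegral.integral_eq_sub_of_hasDerivAt (f := fun r : ℝ => Complex.log (r + w))]
  · simp
  · intro r _
    have h1 : HasDerivAt (fun r : ℝ => (r : ℂ) + w) 1 r := (Complex.ofRealCLM.hasDerivAt).add_const w
    simpa using h1.clog_real (hs r)
  · apply Continuous.intervalIntegrable
    refine Continuous.inv₀ (by fun_prop) fun r => Complex.slitPlane_ne_zero (hs r)

lemma fad_logW_real (a b : ℝ) (ha : 0 ≤ a) (hb : 0 < b) :
    ∫ θ in Set.Ioo (-π) π, Real.log ‖fadW a b θ‖ = 2 * π * Real.log (a + b) := by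
  obtain ⟨s, hs⟩ : ∃ s : ℂ, s ^ 2 = (((b - a) / (a + b) : ℝ) : ℂ) := IsAlgClosed.exists_pow_nat_eq _ (by norm_num)
  have hab : 0 < a + b := by linarith
  have hsn : ‖s‖ ≤ 1 := by
    have : ‖s‖ ^ 2 ≤ 1 := by
      rw [← norm_pow, hs, Complex.norm_real, Real.norm_eq_abs, abs_div, abs_of_pos hab,
        div_le_one hab, abs_le]
      constructor <;> linarith
    nlinarith [norm_nonneg s]
  have hper : Function.Periodic (fun θ => Real.log ‖fadW a b θ‖) (2 * π) := by
    intro θ; simp [fadW]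
  have e1 : ∫ θ in Set.Ioo (-π) π, Real.log ‖fadW a b θ‖ =
      ∫ θ in 0..2 * π, Real.log ‖fadW a b θ‖ := by
    rw [← integral_Ioc_eq_integral_Ioo, ← intervalIntegral.integral_of_le (by linarith [Real.pi_pos])]
    have := hper.intervalIntegral_add_eq (-π) 0
    rw [show -π + 2 * π = π by ring, zero_add] at this
    exact this
  have hfac : ∀ θ, ‖fadW a b θ‖ = (a + b) * (‖circleMap 0 1 θ - s‖ * ‖circleMap 0 1 θ - (-s)‖) := by
    intro θ
    have h0 : ‖Complex.exp (θ * Complex.I)‖ = 1 := Complex.norm_exp_ofReal_mul_I θ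
    have hE : Complex.exp (θ * Complex.I) = Real.cos θ + Real.sin θ * Complex.I := by
      rw [Complex.exp_mul_I]; simp
    have hcs : ((Real.cos θ : ℝ) : ℂ) ^ 2 + ((Real.sin θ : ℝ) : ℂ) ^ 2 = 1 := by
      exact_mod_cast Real.cos_sq_add_sin_sq θ
    have key : Complex.exp (θ * Complex.I) * fadW a b θ =
        ((a + b : ℝ) : ℂ) * ((circleMap 0 1 θ - s) * (circleMap 0 1 θ - (-s))) := by
      have : (circleMap 0 1 θ - s) * (circleMap 0 1 θ - (-s)) = Complex.exp (θ * Complex.I) ^ 2 - s ^ 2 := by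
        simp [circleMap]; ring
      have hab' : ((a : ℂ) + b) ≠ 0 := by exact_mod_cast hab.ne'
      rw [this, hs, hE, fadW]
      push_cast
      field_simp
      have hI : Complex.I ^ 2 = -1 := Complex.I_sq
      push_cast at hcs
      linear_combination (a - b : ℂ) * hcs - (a - b : ℂ) * Complex.sin θ ^ 2 * hI
    have := congrArg norm key
    rw [norm_mul, h0, one_mul, norm_mul, norm_mul, Complex.norm_real, Real.norm_eq_abs,
      abs_of_pos hab] at this
    exact this
  have i1 : ∀ t : ℂ, IntervalIntegrable (fun θ => Real.log ‖circleMap 0 1 θ - t‖) volume 0 (2 * π) :=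
    fun t => circleIntegrable_log_norm_sub_const (a := t) (c := 0) 1
  have v1 : ∀ t : ℂ, ‖t‖ ≤ 1 → ∫ θ in 0..2 * π, Real.log ‖circleMap 0 1 θ - t‖ = 0 := by
    intro t ht
    have := circleAverage_log_norm_sub_const_of_mem_closedBall (a := t) (c := 0) (R := 1)
      (by simpa using ht)
    rw [Real.circleAverage_def, Real.log_one, smul_eq_mul, mul_eq_zero] at this
    rcases this with h | h
    · exact absurd h (by positivity)
    · exact h
  have hne : ∀ᵐ θ : ℝ, fadW a b θ ≠ 0 := by
    have : Set.Countable {θ : ℝ | Real.sin θ = 0} := by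
      have : {θ : ℝ | Real.sin θ = 0} = Set.range (fun n : ℤ => (n : ℝ) * π) := by
        ext θ; simp [Real.sin_eq_zero_iff]
      rw [this]; exact Set.countable_range _
    filter_upwards [this.ae_notMem volume] with θ hθ h0
    apply hθ
    have := congrArg Complex.im h0
    rw [fadW_im, Complex.zero_im] at this
    have h3 : b * Real.sin θ = 0 := by linarith
    exact (mul_eq_zero.1 h3).resolve_left hb.ne'
  have e2 : ∫ θ in 0..2 * π, Real.log ‖fadW a b θ‖ =
      ∫ θ in 0..2 * π, (Real.log (a + b) + (Real.log ‖circleMap 0 1 θ - s‖ +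
        Real.log ‖circleMap 0 1 θ - (-s)‖)) := by
    apply intervalIntegral.integral_congr_ae
    filter_upwards [hne] with θ hθ _
    have := hfac θ
    have h3 := norm_ne_zero_iff.2 hθ
    rw [this] at h3
    have h4 := right_ne_zero_of_mul h3
    rw [this, Real.log_mul hab.ne' h4,
      Real.log_mul (left_ne_zero_of_mul h4) (right_ne_zero_of_mul h4)]
  rw [e1, e2, intervalIntegral.integral_add (by simp) ((i1 s).add (i1 (-s))),
    intervalIntegral.integral_add (i1 s) (i1 (-s)), v1 s hsn, v1 (-s) (by simpa using hsn)]
  simp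

lemma fad_norm_abs (a b θ : ℝ) : ‖fadW a b θ‖ = ‖fadW |a| b θ‖ := by
  rw [← sq_eq_sq₀ (norm_nonneg _) (norm_nonneg _), ← Complex.normSq_eq_norm_sq,
    ← Complex.normSq_eq_norm_sq, Complex.normSq_apply, Complex.normSq_apply]
  simp only [fadW_re, fadW_im]
  linear_combination (-4 * Real.cos θ ^ 2) * sq_abs a

lemma fad_norm_le (a b θ : ℝ) (hb : 0 < b) : ‖fadW a b θ‖ ≤ 2 * (|a| + b) := by
  refine (Complex.norm_le_abs_re_add_abs_im _).trans ?_
  rw [fadW_re, fadW_im, abs_mul, abs_mul, abs_mul, abs_mul, abs_of_pos hb]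
  have h1 := Real.abs_cos_le_one θ
  have h2 := Real.abs_sin_le_one θ
  have : |(2:ℝ)| = 2 := by norm_num
  rw [this]
  nlinarith [abs_nonneg a]

lemma fad_sin_ne (θ : ℝ) (h : θ ∈ Set.Ioo (-π) π) (h0 : θ ≠ 0) : Real.sin θ ≠ 0 := by
  intro h1
  exact h0 ((Real.sin_eq_zero_iff_of_lt_of_lt h.1 h.2).1 h1)

lemma fad_log_integral (a b : ℝ) (hb : 0 < b)
    (hi : IntegrableOn (fun θ => Complex.log (fadW a b θ)) (Set.Ioo (-π) π)) :
    ∫ θ in Set.Ioo (-π) π, Complex.log (fadW a b θ) = ((2 * π * Real.log (|a| + b) : ℝ) : ℂ) := by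
  apply Complex.ext
  · have := (Complex.reCLM.integral_comp_comm hi)
    simp only [Complex.reCLM_apply, Complex.log_re] at this
    rw [← this, Complex.ofReal_re, ← fad_logW_real |a| b (abs_nonneg a) hb]
    simp only [← fad_norm_abs]
  · have := (Complex.imCLM.integral_comp_comm hi)
    simp only [Complex.imCLM_apply, Complex.log_im] at this
    rw [← this, Complex.ofReal_im]
    have e : ∫ θ in Set.Ioo (-π) π, (fadW a b θ).arg =
        ∫ θ in Set.Ioo (-π) π, (fadW a b (-θ)).arg := by
      rw [← integral_Ioc_eq_integral_Ioo, ← integral_Ioc_eq_integral_Ioo,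
        ← intervalIntegral.integral_of_le (by linarith [Real.pi_pos]),
        ← intervalIntegral.integral_of_le (by linarith [Real.pi_pos]),
        intervalIntegral.integral_comp_neg (fun θ => (fadW a b θ).arg), neg_neg]
    have e2 : ∫ θ in Set.Ioo (-π) π, (fadW a b (-θ)).arg =
        ∫ θ in Set.Ioo (-π) π, -(fadW a b θ).arg := by
      apply integral_congr_ae
      filter_upwards [ae_restrict_of_ae (Measure.ae_ne volume (0:ℝ)),
        ae_restrict_mem measurableSet_Ioo] with θ h0 hθ
      have hc : fadW a b (-θ) = (starRingEnd ℂ) (fadW a b θ) := by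
        apply Complex.ext
        · rw [Complex.conj_re, fadW_re, fadW_re, Real.cos_neg]
        · rw [Complex.conj_im, fadW_im, fadW_im, Real.sin_neg]; ring
      rw [hc, Complex.arg_conj, if_neg]
      intro h
      have := (Complex.arg_eq_pi_iff.1 h).2
      rw [fadW_im] at this
      have h3 : b * Real.sin θ = 0 := by linarith
      exact fad_sin_ne θ hθ h0 ((mul_eq_zero.1 h3).resolve_left hb.ne')
    rw [e2, integral_neg] at e
    linarith

lemma fad_main (a b : ℝ) (hb : 0 < b) (N : ℝ) (hN : 4 * (|a| + b) ≤ N) :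
    ‖(∫ z in Metric.closedBall (0 : ℂ) N, fadF a b z)
      - 2 * Real.pi * Real.log N + 2 * Real.pi * Real.log (|a| + b)‖
      ≤ (2 * π * (3 * (|a| + b))) / N := by
  have hab : 0 < |a| + b := by have := abs_nonneg a; linarith
  have hN0 : 0 < N := by linarith
  obtain ⟨hG, hE⟩ := fad_polar a b N hb hN0
  rw [hE]
  rw [IntegrableOn, Measure.volume_eq_prod, ← Measure.prod_restrict] at hG
  rw [Measure.volume_eq_prod, ← Measure.prod_restrict, integral_prod_symm _ hG]
  have hI := hG.integral_prod_right
  have hNC : (N : ℂ) ≠ 0 := by exact_mod_cast hN0.ne'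
  have hq : ∀ θ, ‖fadW a b θ / N‖ ≤ 1 / 2 := by
    intro θ
    rw [norm_div, Complex.norm_real, Real.norm_eq_abs, abs_of_pos hN0, div_le_iff₀ hN0]
    linarith [fad_norm_le a b θ hb]
  have hlog : ∀ θ, Complex.log (N + fadW a b θ) =
      ((Real.log N : ℝ) : ℂ) + Complex.log (1 + fadW a b θ / N) := by
    intro θ
    have h1 : (N : ℂ) + fadW a b θ = N * (1 + fadW a b θ / N) := by field_simp
    rw [h1, Complex.log_ofReal_mul hN0]
    intro h
    have h2 : fadW a b θ / N = -1 := by linear_combination h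
    have := hq θ
    rw [h2] at this; norm_num at this
  have hcont : Continuous (fun θ => Complex.log (1 + fadW a b θ / N)) := by
    have := fadW_cont a b
    refine Continuous.clog (by fun_prop) ?_
    intro θ
    apply Complex.mem_slitPlane_of_norm_lt_one
    exact lt_of_le_of_lt (hq θ) (by norm_num)
  have hEint : IntegrableOn (fun θ => Complex.log (1 + fadW a b θ / N)) (Set.Ioo (-π) π) :=
    (hcont.continuousOn.integrableOn_compact isCompact_Icc).mono_set Set.Ioo_subset_Icc_self
  have hconst : IntegrableOn (fun _ : ℝ => ((Real.log N : ℝ) : ℂ)) (Set.Ioo (-π) π) := by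
    exact integrableOn_const (by simp) (by simp)
  have hae : (fun θ => ∫ r in Set.Ioc 0 N, ((r : ℂ) + fadW a b θ)⁻¹) =ᵐ[volume.restrict (Set.Ioo (-π) π)]
      fun θ => (((Real.log N : ℝ) : ℂ) + Complex.log (1 + fadW a b θ / N)) - Complex.log (fadW a b θ) := by
    filter_upwards [ae_restrict_of_ae (Measure.ae_ne volume (0:ℝ)),
        ae_restrict_mem measurableSet_Ioo] with θ h0 hθ
    rw [fad_inner _ N hN0, hlog]
    rw [fadW_im]
    have := fad_sin_ne θ hθ h0
    positivity
  have hsum : IntegrableOn (fun θ => ((Real.log N : ℝ) : ℂ) + Complex.log (1 + fadW a b θ / N))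
      (Set.Ioo (-π) π) := hconst.add hEint
  have hW : IntegrableOn (fun θ => Complex.log (fadW a b θ)) (Set.Ioo (-π) π) := by
    have h1 := (hconst.add hEint).sub (hI.congr hae)
    refine h1.congr (Filter.Eventually.of_forall fun θ => ?_)
    simp
  rw [integral_congr_ae hae, integral_sub hsum hW, integral_add hconst hEint,
    fad_log_integral a b hb hW]
  have hvol : volume.real (Set.Ioo (-π) π) = 2 * π := by
    rw [Real.volume_real_Ioo_of_le (by linarith [Real.pi_pos])]; ring
  have hc : ∫ θ in Set.Ioo (-π) π, ((Real.log N : ℝ) : ℂ) = 2 * π * Real.log N := by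
    rw [setIntegral_const, hvol, Complex.real_smul]; push_cast; ring
  rw [hc]
  have hb2 : ‖∫ θ in Set.Ioo (-π) π, Complex.log (1 + fadW a b θ / N)‖ ≤
      (3 * (|a| + b) / N) * volume.real (Set.Ioo (-π) π) := by
    apply norm_setIntegral_le_of_norm_le_const (by simp)
    intro θ _
    refine (Complex.norm_log_one_add_half_le_self (hq θ)).trans ?_
    rw [norm_div, Complex.norm_real, Real.norm_eq_abs, abs_of_pos hN0]
    rw [← mul_div_assoc]
    refine div_le_div_of_nonneg_right ?_ hN0.le
    linarith [fad_norm_le a b θ hb]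
  rw [hvol] at hb2
  refine le_trans (le_of_eq ?_) (hb2.trans (le_of_eq (by ring)))
  congr 1
  push_cast; ring

lemma fad_coords (p q : EuclideanSpace ℝ (Fin 2)) (hq : q ≠ 0) (hpq : (inner ℝ p q : ℝ) = 0) :
    ∃ (φ : ℂ ≃ₗᵢ[ℝ] EuclideanSpace ℝ (Fin 2)) (a : ℝ), |a| = ‖p‖ ∧
      ∀ z, (inner ℝ p (φ z) : ℝ) = a * z.re ∧ (inner ℝ q (φ z) : ℝ) = ‖q‖ * z.im := by
  have hq0 : ‖q‖ ≠ 0 := norm_ne_zero_iff.2 hq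
  obtain ⟨B, hB⟩ := Orthonormal.exists_orthonormalBasis_extension_of_card_eq (𝕜 := ℝ)
    (E := EuclideanSpace ℝ (Fin 2)) (ι := Fin 2) (by simp)
    (v := fun _ => (‖q‖⁻¹ : ℝ) • q) (s := {1}) (by
      rw [orthonormal_iff_ite]
      rintro ⟨i, hi⟩ ⟨j, hj⟩
      simp only [Set.mem_singleton_iff] at hi hj
      subst hi; subst hj
      simp only [Set.domRestrict_apply, if_true]
      rw [real_inner_self_eq_norm_sq, norm_smul, norm_inv, norm_norm, inv_mul_cancel₀ hq0, one_pow])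
  have hB1 : B 1 = (‖q‖⁻¹ : ℝ) • q := hB 1 rfl
  have hqB : q = ‖q‖ • B 1 := by rw [hB1, smul_smul, mul_inv_cancel₀ hq0, one_smul]
  have hp1 : (inner ℝ p (B 1) : ℝ) = 0 := by rw [hB1, inner_smul_right, hpq, mul_zero]
  have h10 : (inner ℝ (B 1) (B 0) : ℝ) = 0 := B.orthonormal.2 (by decide)
  have h11 : (inner ℝ (B 1) (B 1) : ℝ) = 1 := by
    rw [real_inner_self_eq_norm_sq, B.orthonormal.1 1, one_pow]
  refine ⟨Complex.isometryOfOrthonormal B, inner ℝ p (B 0), ?_, ?_⟩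
  · have := B.sum_sq_norm_inner_left p
    rw [Fin.sum_univ_two, hp1] at this
    rw [← sq_eq_sq₀ (abs_nonneg _) (norm_nonneg _), ← this]
    simp
  · intro z
    rw [Complex.isometryOfOrthonormal_apply]
    constructor
    · rw [inner_add_right, inner_smul_right, inner_smul_right, hp1]; ring
    · nth_rewrite 1 [hqB]
      rw [inner_smul_left, inner_add_right, inner_smul_right, inner_smul_right, h10, h11]; simp


/-- Let `p, q ∈ ℝ²` with `q ≠ 0` and `p·q = 0`. Then for every `N > 0` the function
`ξ ↦ (‖ξ‖² + 2 p·ξ + 2i q·ξ)⁻¹` is Lebesgue integrable on the disc `{‖ξ‖ ≤ N}`, and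
`∫_{‖ξ‖≤N} (‖ξ‖² + 2 p·ξ + 2i q·ξ)⁻¹ dξ = 2π ln(N/(|p|+|q|)) + O(N⁻¹)` as `N → ∞`. -/
theorem faddeev_green_symbol_integral_asymptotics
    (p q : EuclideanSpace ℝ (Fin 2)) (hq : q ≠ 0) (hpq : (inner ℝ p q : ℝ) = 0) :
    (∀ N : ℝ, 0 < N →
      IntegrableOn
        (fun ξ : EuclideanSpace ℝ (Fin 2) =>
          (((‖ξ‖ ^ 2 + 2 * (inner ℝ p ξ : ℝ) : ℝ) : ℂ)
            + 2 * Complex.I * ((inner ℝ q ξ : ℝ) : ℂ))⁻¹)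
        (Metric.closedBall 0 N)) ∧
    ∃ C > (0:ℝ), ∃ N₀ > (0:ℝ), ∀ N ≥ N₀,
      ‖(∫ ξ in Metric.closedBall (0 : EuclideanSpace ℝ (Fin 2)) N,
          (((‖ξ‖ ^ 2 + 2 * (inner ℝ p ξ : ℝ) : ℝ) : ℂ)
            + 2 * Complex.I * ((inner ℝ q ξ : ℝ) : ℂ))⁻¹)
        - 2 * Real.pi * Real.log N + 2 * Real.pi * Real.log (‖p‖ + ‖q‖)‖
      ≤ C / N := by
  obtain ⟨φ, a, ha, hφ⟩ := fad_coords p q hq hpq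
  have hb : 0 < ‖q‖ := norm_pos_iff.2 hq
  set f : EuclideanSpace ℝ (Fin 2) → ℂ := fun ξ =>
          (((‖ξ‖ ^ 2 + 2 * (inner ℝ p ξ : ℝ) : ℝ) : ℂ)
            + 2 * Complex.I * ((inner ℝ q ξ : ℝ) : ℂ))⁻¹ with hf
  have hcomp : f ∘ φ = fadF a ‖q‖ := by
    funext z
    simp only [hf, Function.comp, fadF, (hφ z).1, (hφ z).2, LinearIsometryEquiv.norm_map]
  have hpre : ∀ N, φ ⁻¹' (Metric.closedBall 0 N) = Metric.closedBall (0 : ℂ) N := by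
    intro N
    ext z; simp
  have hmp := φ.measurePreserving
  have hme : MeasurableEmbedding φ := φ.toHomeomorph.measurableEmbedding
  refine ⟨fun N hN => ?_, 2 * π * (3 * (|a| + ‖q‖)), by positivity, 4 * (|a| + ‖q‖), by positivity,
    fun N hN => ?_⟩
  · rw [← hmp.integrableOn_comp_preimage hme, hcomp, hpre]
    exact fad_integrableOn a ‖q‖ N hb hN
  · have h1 := hmp.setIntegral_preimage_emb hme f (Metric.closedBall 0 N)
    rw [hpre] at h1
    have h2 := fad_main a ‖q‖ hb N hN
    rw [← hcomp] at h2
    simp only [Function.comp] at h2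
    rw [h1, ha] at h2
    rw [ha]
    exact h2
end

section
/- Let α ∈ ℝ, α ≠ 0, and let p, q ∈ ℝ² with q ≠ 0, p·q = 0, and 1 − (α/(2π)) ln(|p| + |q|) ≠ 0. For N > 1 with (α/(2π)) ln N ≠ 1 set ε(N) := α/(1 − (α/(2π)) ln N) and I_N := ∫_{‖ζ‖≤N} (‖ζ‖² + 2 p·ζ + 2i q·ζ)⁻¹ dζ. Then lim_{N→∞} ε(N)/(1 + ε(N)·(2π)⁻²·I_N) = α/(1 − (α/(2π)) ln(|p| + |q|)). -/
open MeasureTheory Real Filter Topology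

lemma circ_exp (a b r θ : ℝ) :
    ((r + 2 * a * Real.cos θ : ℝ) : ℂ) + 2 * Complex.I * ((b * Real.sin θ : ℝ) : ℂ)
      = r + (a + b) * circleMap 0 1 θ + (a - b) * (circleMap 0 1 θ)⁻¹ := by
  have h : (circleMap 0 1 θ)⁻¹ = Complex.exp (-(θ * Complex.I)) := by
    simp [circleMap, Complex.exp_neg]
  rw [h]
  simp only [circleMap, Complex.ofReal_one, one_mul, zero_add]
  rw [← neg_mul, Complex.exp_mul_I, Complex.exp_mul_I, Complex.cos_neg, Complex.sin_neg]
  push_cast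
  ring

lemma theta_shift (a b r : ℝ) :
    (∫ θ in (-π)..π,
      (((r + 2 * a * Real.cos θ : ℝ) : ℂ) + 2 * Complex.I * ((b * Real.sin θ : ℝ) : ℂ))⁻¹)
    = ∫ θ in 0..(2 * π),
      (((r + 2 * a * Real.cos θ : ℝ) : ℂ) + 2 * Complex.I * ((b * Real.sin θ : ℝ) : ℂ))⁻¹ := by
  have hp : Function.Periodic (fun θ : ℝ =>
      (((r + 2 * a * Real.cos θ : ℝ) : ℂ) + 2 * Complex.I * ((b * Real.sin θ : ℝ) : ℂ))⁻¹)
      (2 * π) := by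
    intro θ
    simp only [Real.cos_add_two_pi, Real.sin_add_two_pi]
  have := hp.intervalIntegral_add_eq (-π) 0
  rw [zero_add] at this
  rw [← this]
  congr 1
  ring

lemma theta_neg (a b r : ℝ) :
    (∫ θ in (-π)..π,
      (((r + 2 * a * Real.cos θ : ℝ) : ℂ) + 2 * Complex.I * ((b * Real.sin θ : ℝ) : ℂ))⁻¹)
    = ∫ θ in (-π)..π,
      (((r + 2 * a * Real.cos θ : ℝ) : ℂ) + 2 * Complex.I * (((-b) * Real.sin θ : ℝ) : ℂ))⁻¹ := by
  have := intervalIntegral.integral_comp_neg (a := -π) (b := π) (fun θ : ℝ =>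
      (((r + 2 * a * Real.cos θ : ℝ) : ℂ) + 2 * Complex.I * ((b * Real.sin θ : ℝ) : ℂ))⁻¹)
  rw [neg_neg] at this
  rw [← this]
  congr 1
  ext θ
  simp

lemma theta_small (a b r : ℝ) (hb : 0 < b) (hr : 0 < r) (hra : r < 2 * a) :
    (∫ θ in (-π)..π,
      (((r + 2 * a * Real.cos θ : ℝ) : ℂ) + 2 * Complex.I * ((b * Real.sin θ : ℝ) : ℂ))⁻¹) = 0 := by
  have ha : 0 < a := by linarith
  rw [theta_neg, theta_shift]
  have hne : ∀ w : ℂ, ‖w‖ ≤ 1 → ((a + b : ℝ) : ℂ) + r * w + ((a - b : ℝ) : ℂ) * w ^ 2 ≠ 0 := by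
    intro w hw h0
    have hw2 : w.re ^ 2 + w.im ^ 2 ≤ 1 := by
      have := Complex.sq_norm w
      rw [Complex.normSq_apply] at this
      nlinarith [norm_nonneg w]
    have hre := congrArg Complex.re h0
    have him := congrArg Complex.im h0
    simp [pow_two] at hre him
    have key : ((a + b) - (a - b) * (w.re ^ 2 + w.im ^ 2)) * w.im = 0 := by
      linear_combination (-w.im) * hre * (-1) + w.re * him * (-1)
    rcases mul_eq_zero.1 key with h | h
    · nlinarith [sq_nonneg w.re, sq_nonneg w.im]
    · rw [h] at hre hw2
      have : a * (1 - |w.re|) ^ 2 + b * (1 - w.re ^ 2) + (2 * a * |w.re| + r * w.re) = 0 := by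
        have := sq_abs w.re
        nlinarith
      have h1 : -|w.re| ≤ w.re := neg_abs_le _
      have h2 := abs_nonneg w.re
      have h3 : 0 ≤ r * (w.re + |w.re|) := by apply mul_nonneg hr.le; linarith
      have h4 : 0 ≤ b * (1 - w.re ^ 2) := by apply mul_nonneg hb.le; nlinarith
      have h5 : 0 ≤ a * (1 - |w.re|) ^ 2 := by positivity
      have h6 : 0 ≤ (2 * a - r) * |w.re| := by apply mul_nonneg _ h2; linarith
      have h7 : (2 * a - r) * |w.re| = 0 := by nlinarith
      rcases mul_eq_zero.1 h7 with h8 | h8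
      · linarith
      · rw [abs_eq_zero] at h8
        rw [h8] at this
        simp at this
        linarith
  have hc : (∮ z in C(0, 1), Complex.I⁻¹ *
      (((a + b : ℝ) : ℂ) + r * z + ((a - b : ℝ) : ℂ) * z ^ 2)⁻¹) = 0 := by
    apply DiffContOnCl.circleIntegral_eq_zero zero_le_one
    apply DifferentiableOn.diffContOnCl
    rw [closure_ball _ one_ne_zero]
    intro w hw
    apply DifferentiableAt.differentiableWithinAt
    apply DifferentiableAt.const_mul
    apply DifferentiableAt.inv (by fun_prop)
    exact hne w (by simpa using hw)
  rw [← hc, circleIntegral]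
  congr 1
  ext θ
  rw [circ_exp]
  have hw : circleMap 0 1 θ ≠ 0 := circleMap_ne_center one_ne_zero
  have hw1 : ‖circleMap 0 1 θ‖ ≤ 1 := by simp
  have := hne _ hw1
  rw [deriv_circleMap, smul_eq_mul]
  set w := circleMap 0 1 θ
  have e : (r : ℂ) + (a + ((-b : ℝ) : ℂ)) * w + (a - ((-b : ℝ) : ℂ)) * w⁻¹
     = w⁻¹ * (((a + b : ℝ) : ℂ) + r * w + ((a - b : ℝ) : ℂ) * w ^ 2) := by
    field_simp
    push_cast
    ring
  rw [e, mul_inv, inv_inv]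
  have := Complex.I_ne_zero
  field_simp

lemma theta_large (a b r : ℝ) (ha : 0 ≤ a) (hb : 0 < b) (hra : 2 * a < r) :
    (∫ θ in (-π)..π,
      (((r + 2 * a * Real.cos θ : ℝ) : ℂ) + 2 * Complex.I * ((b * Real.sin θ : ℝ) : ℂ))⁻¹)
      = ((2 * π * (Real.sqrt (r ^ 2 - 4 * a ^ 2 + 4 * b ^ 2))⁻¹ : ℝ) : ℂ) := by
  rw [theta_shift]
  have hpos : 0 < r ^ 2 - 4 * a ^ 2 + 4 * b ^ 2 := by nlinarith
  obtain ⟨s, hs⟩ : ∃ s, s = Real.sqrt (r ^ 2 - 4 * a ^ 2 + 4 * b ^ 2) := ⟨_, rfl⟩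
  rw [← hs]
  have hs0 : 0 < s := by rw [hs]; exact Real.sqrt_pos.2 hpos
  have hs2 : s ^ 2 = r ^ 2 - 4 * a ^ 2 + 4 * b ^ 2 := by rw [hs]; exact Real.sq_sqrt hpos.le
  have hA : 0 < 2 * (a + b) := by linarith
  obtain ⟨z1, hz1⟩ : ∃ z, z = (-r + s) / (2 * (a + b)) := ⟨_, rfl⟩
  obtain ⟨z2, hz2⟩ : ∃ z, z = (-r - s) / (2 * (a + b)) := ⟨_, rfl⟩
  have h1 : |z1| < 1 := by
    rw [abs_lt, hz1, lt_div_iff₀ hA, div_lt_iff₀ hA]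
    constructor
    · by_contra! h
      nlinarith
    · by_contra! h
      nlinarith
  have h2 : z2 < -1 := by
    rw [hz2, div_lt_iff₀ hA]
    have : 2 * b < s := by
      by_contra! h
      nlinarith
    linarith
  have hsum : (a + b) * (z1 + z2) = - r := by rw [hz1, hz2]; field_simp; ring
  have hprod : (a + b) * (z1 * z2) = a - b := by
    rw [hz1, hz2]; field_simp; nlinarith
  have hdiff : (a + b) * (z1 - z2) = s := by rw [hz1, hz2]; field_simp; ring
  have hn1 : ∀ w : ℂ, ‖w‖ = 1 → w - z1 ≠ 0 := by
    intro w hw h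
    have : w = z1 := by linear_combination h
    rw [this, Complex.norm_real, Real.norm_eq_abs] at hw
    linarith
  have hn2 : ∀ w : ℂ, ‖w‖ ≤ 1 → w - z2 ≠ 0 := by
    intro w hw h
    have : w = z2 := by linear_combination h
    rw [this, Complex.norm_real, Real.norm_eq_abs] at hw
    linarith [neg_le_abs z2]
  have hc1 : (∮ z in C(0, 1), (z - (z1 : ℂ))⁻¹) = 2 * π * Complex.I := by
    apply circleIntegral.integral_sub_inv_of_mem_ball
    simpa using h1
  have hc2 : (∮ z in C(0, 1), (z - (z2 : ℂ))⁻¹) = 0 := by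
    apply DiffContOnCl.circleIntegral_eq_zero zero_le_one
    apply DifferentiableOn.diffContOnCl
    rw [closure_ball _ one_ne_zero]
    intro w hw
    apply DifferentiableAt.differentiableWithinAt
    apply DifferentiableAt.inv (by fun_prop)
    exact hn2 w (by simpa using hw)
  have hi1 : CircleIntegrable (fun z => (z - (z1 : ℂ))⁻¹) 0 1 := by
    apply ContinuousOn.circleIntegrable zero_le_one
    apply ContinuousOn.inv₀ (by fun_prop)
    intro w hw
    exact hn1 w (by simpa using hw)
  have hi2 : CircleIntegrable (fun z => (z - (z2 : ℂ))⁻¹) 0 1 := by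
    apply ContinuousOn.circleIntegrable zero_le_one
    apply ContinuousOn.inv₀ (by fun_prop)
    intro w hw
    exact hn2 w (by simpa using (le_of_eq (by simpa using hw)))
  have hc : (∮ z in C(0, 1), (Complex.I⁻¹ * (s : ℂ)⁻¹) *
      ((z - (z1 : ℂ))⁻¹ - (z - (z2 : ℂ))⁻¹)) = 2 * π * (s : ℂ)⁻¹ := by
    rw [circleIntegral.integral_const_mul, circleIntegral.integral_sub hi1 hi2, hc1, hc2]
    have := Complex.I_ne_zero
    field_simp
    simp
  push_cast
  rw [← hc, circleIntegral]
  congr 1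
  ext θ
  have := circ_exp a b r θ
  push_cast at this
  rw [this]
  have hw : circleMap 0 1 θ ≠ 0 := circleMap_ne_center one_ne_zero
  have hw1 : ‖circleMap 0 1 θ‖ = 1 := by simp
  have hz1 := hn1 _ hw1
  have hz2 := hn2 _ hw1.le
  rw [deriv_circleMap, smul_eq_mul]
  set w := circleMap 0 1 θ
  have hsC : (s : ℂ) ≠ 0 := by exact_mod_cast hs0.ne'
  have hAC : (a + b : ℂ) ≠ 0 := by exact_mod_cast (by linarith : a + b ≠ 0)
  have hsumC : (a + b : ℂ) * (z1 + z2) = - r := by exact_mod_cast hsum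
  have hprodC : (a + b : ℂ) * (z1 * z2) = a - b := by exact_mod_cast hprod
  have hdiffC : (a + b : ℂ) * (z1 - z2) = s := by exact_mod_cast hdiff
  have e : (r : ℂ) + (a + b) * w + (a - b) * w⁻¹
     = w⁻¹ * ((a + b) * (w - z1) * (w - z2)) := by
    field_simp
    linear_combination w * hsumC - hprodC
  rw [e, mul_inv, inv_inv]
  have := Complex.I_ne_zero
  field_simp
  linear_combination -hdiffC

lemma abs_rpow_int (M : ℝ) (c : ℝ) :
    IntegrableOn (fun x : ℝ => |x + c| ^ (-(2/3) : ℝ)) (Set.Icc (-M) M) := by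
  have h0 : ∀ u v : ℝ, IntervalIntegrable (fun x : ℝ => |x| ^ (-(2/3) : ℝ)) volume u v := by
    have hp : ∀ v : ℝ, 0 ≤ v → IntervalIntegrable (fun x : ℝ => |x| ^ (-(2/3) : ℝ)) volume 0 v := by
      intro v hv
      have := intervalIntegral.intervalIntegrable_rpow' (a := 0) (b := v) (r := -(2/3)) (by norm_num)
      refine this.congr ?_
      intro x hx
      rw [Set.uIoc_of_le hv] at hx
      simp only [abs_of_pos hx.1]
    have hall : ∀ v : ℝ, IntervalIntegrable (fun x : ℝ => |x| ^ (-(2/3) : ℝ)) volume 0 v := by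
      intro v
      rcases le_total 0 v with hv | hv
      · exact hp v hv
      · have := (hp (-v) (by linarith)).comp_sub_left 0
        simpa using this
    intro u v
    exact (hall u).symm.trans (hall v)
  rcases le_or_gt (-M) M with hM | hM
  · have := (h0 (-M + c) (M + c)).comp_add_right c
    simp only [add_sub_cancel_right] at this
    rw [intervalIntegrable_iff_integrableOn_Icc_of_le hM] at this
    exact this
  · simp [Set.Icc_eq_empty (not_le.2 hM)]

noncomputable def DD (a b : ℝ) (z : ℝ × ℝ) : ℂ :=
  ((z.1 ^ 2 + z.2 ^ 2 + 2 * a * z.1 : ℝ) : ℂ) + 2 * Complex.I * ((b * z.2 : ℝ) : ℂ)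

lemma DD_bound (a b M x y : ℝ) (hb : 0 < b) (hM : 0 < M) (hx : x ≠ 0) (hxa : x + 2 * a ≠ 0)
    (hy : y ≠ 0) (hyM : |y| ≤ M) :
    ‖(DD a b (x, y))⁻¹‖ ≤ ((1 + M / (2 * b)) ^ (1/3 : ℝ) * (2 * b) ^ (-(2/3) : ℝ)) *
      ((|x + 0| ^ (-(2/3) : ℝ) + |x + 2 * a| ^ (-(2/3) : ℝ)) * |y + 0| ^ (-(2/3) : ℝ)) := by
  rw [add_zero, add_zero]
  set d := ‖DD a b (x, y)‖ with hd
  have hre : |x ^ 2 + y ^ 2 + 2 * a * x| ≤ d := by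
    have := Complex.abs_re_le_norm (DD a b (x, y))
    have e : (DD a b (x, y)).re = x ^ 2 + y ^ 2 + 2 * a * x := by simp [DD, pow_two]
    rwa [e] at this
  have him : 2 * b * |y| ≤ d := by
    have := Complex.abs_im_le_norm (DD a b (x, y))
    have e : (DD a b (x, y)).im = 2 * b * y := by simp [DD, pow_two]; ring
    rw [e, abs_mul, abs_of_pos (by linarith : 0 < 2 * b)] at this
    exact this
  have hy0 : 0 < |y| := abs_pos.2 hy
  have hx0 : 0 < |x| := abs_pos.2 hx
  have hxa0 : 0 < |x + 2 * a| := abs_pos.2 hxa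
  have hdpos : 0 < d := lt_of_lt_of_le (by positivity) him
  have hK : 0 < 1 + M / (2 * b) := by positivity
  have hxx : |x| * |x + 2 * a| ≤ (1 + M / (2 * b)) * d := by
    rw [← abs_mul]
    have e : x * (x + 2 * a) = (x ^ 2 + y ^ 2 + 2 * a * x) - y ^ 2 := by ring
    rw [e]
    have h1 := abs_sub (x ^ 2 + y ^ 2 + 2 * a * x) (y ^ 2)
    have h2 : |y ^ 2| ≤ M * |y| := by
      rw [abs_pow, pow_two]; exact mul_le_mul_of_nonneg_right hyM hy0.le
    have h3 : M * |y| ≤ M / (2 * b) * d := by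
      calc M * |y| = M / (2 * b) * (2 * b * |y|) := by field_simp
        _ ≤ _ := by gcongr
    linarith
  have h1 : d ^ (-(1/3) : ℝ) ≤ (1 + M / (2 * b)) ^ (1/3 : ℝ) * (|x| * |x + 2 * a|) ^ (-(1/3) : ℝ) := by
    have := Real.rpow_le_rpow_of_nonpos (z := -(1/3)) (by positivity) hxx (by norm_num)
    rw [Real.mul_rpow hK.le hdpos.le, Real.rpow_neg hK.le] at this
    have hKp : 0 < (1 + M / (2 * b)) ^ (1/3 : ℝ) := by positivity
    rw [inv_mul_le_iff₀ hKp] at this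
    exact this
  have h2 : d ^ (-(2/3) : ℝ) ≤ (2 * b) ^ (-(2/3) : ℝ) * |y| ^ (-(2/3) : ℝ) := by
    rw [← Real.mul_rpow (by linarith) hy0.le]
    exact Real.rpow_le_rpow_of_nonpos (by positivity) him (by norm_num)
  have h3 : (|x| * |x + 2 * a|) ^ (-(1/3) : ℝ) ≤
      |x| ^ (-(2/3) : ℝ) + |x + 2 * a| ^ (-(2/3) : ℝ) := by
    rw [Real.mul_rpow hx0.le hxa0.le]
    have e1 : ∀ u : ℝ, 0 < u → u ^ (-(2/3) : ℝ) = (u ^ (-(1/3) : ℝ)) ^ 2 := by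
      intro u hu
      rw [← Real.rpow_natCast, ← Real.rpow_mul hu.le]
      norm_num
    rw [e1 _ hx0, e1 _ hxa0]
    nlinarith [sq_nonneg (|x| ^ (-(1/3) : ℝ) - |x + 2 * a| ^ (-(1/3) : ℝ)),
      sq_nonneg (|x| ^ (-(1/3) : ℝ)), sq_nonneg (|x + 2 * a| ^ (-(1/3) : ℝ))]
  rw [norm_inv, ← hd]
  have e : d⁻¹ = d ^ (-(1/3) : ℝ) * d ^ (-(2/3) : ℝ) := by
    rw [← Real.rpow_add hdpos, ← Real.rpow_neg_one]
    norm_num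
  rw [e]
  calc _ ≤ ((1 + M / (2 * b)) ^ (1/3 : ℝ) * (|x| ^ (-(2/3) : ℝ) + |x + 2 * a| ^ (-(2/3) : ℝ)))
        * ((2 * b) ^ (-(2/3) : ℝ) * |y| ^ (-(2/3) : ℝ)) := by
        apply mul_le_mul (h1.trans _) h2 (by positivity) (by positivity)
        gcongr
    _ = _ := by ring

lemma DD_meas (a b : ℝ) : Measurable (DD a b) := by
  unfold DD
  fun_prop

lemma DD_integrable (a b M : ℝ) (hb : 0 < b) (hM : 0 < M) :
    IntegrableOn (fun z => (DD a b z)⁻¹) (Set.Icc (-M) M ×ˢ Set.Icc (-M) M) := by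
  have hg : Integrable (fun z : ℝ × ℝ => ((1 + M / (2 * b)) ^ (1/3 : ℝ) * (2 * b) ^ (-(2/3) : ℝ)) *
      ((|z.1 + 0| ^ (-(2/3) : ℝ) + |z.1 + 2 * a| ^ (-(2/3) : ℝ)) * |z.2 + 0| ^ (-(2/3) : ℝ)))
      ((volume.restrict (Set.Icc (-M) M)).prod (volume.restrict (Set.Icc (-M) M))) := by
    apply Integrable.const_mul
    exact Integrable.mul_prod (f := fun x : ℝ => |x + 0| ^ (-(2/3) : ℝ) + |x + 2 * a| ^ (-(2/3) : ℝ))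
      (g := fun y : ℝ => |y + 0| ^ (-(2/3) : ℝ))
      ((abs_rpow_int M 0).add (abs_rpow_int M (2 * a))) (abs_rpow_int M 0)
  rw [IntegrableOn, Measure.volume_eq_prod, ← Measure.prod_restrict]
  refine hg.mono' (DD_meas a b).inv.aestronglyMeasurable ?_
  have hne : ∀ c : ℝ, ∀ᵐ x ∂(volume.restrict (Set.Icc (-M) M)), x ≠ c := fun c =>
    ae_restrict_of_ae (Measure.ae_ne volume c)
  have hmem : ∀ᵐ x ∂(volume.restrict (Set.Icc (-M) M)), x ∈ Set.Icc (-M) M :=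
    ae_restrict_mem measurableSet_Icc
  filter_upwards [Measure.quasiMeasurePreserving_fst.ae (hne 0),
    Measure.quasiMeasurePreserving_fst.ae (hne (-(2 * a))),
    Measure.quasiMeasurePreserving_snd.ae (hne 0),
    Measure.quasiMeasurePreserving_snd.ae hmem] with z h1 h2 h3 h4
  exact DD_bound a b M z.1 z.2 hb hM h1 (fun h => h2 (by linarith)) h3 (abs_le.2 h4)

lemma radial (a b N : ℝ) (ha : 0 ≤ a) (hb : 0 < b) (hN : 2 * a < N) :
    ∫ r in (2 * a)..N, 2 * π * (Real.sqrt (r ^ 2 - 4 * a ^ 2 + 4 * b ^ 2))⁻¹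
    = 2 * π * (Real.log (N + Real.sqrt (N ^ 2 - 4 * a ^ 2 + 4 * b ^ 2))
        - Real.log (2 * a + 2 * b)) := by
  have hpos : ∀ r ∈ Set.uIcc (2 * a) N, 0 < r ^ 2 - 4 * a ^ 2 + 4 * b ^ 2 := by
    intro r hr
    rw [Set.uIcc_of_le hN.le] at hr
    nlinarith [hr.1]
  have hderiv : ∀ r ∈ Set.uIcc (2 * a) N,
      HasDerivAt (fun r : ℝ => Real.log (r + Real.sqrt (r ^ 2 - 4 * a ^ 2 + 4 * b ^ 2)))
        (Real.sqrt (r ^ 2 - 4 * a ^ 2 + 4 * b ^ 2))⁻¹ r := by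
    intro r hr
    have hp := hpos r hr
    rw [Set.uIcc_of_le hN.le] at hr
    have hr0 : 0 ≤ r := by linarith [hr.1]
    have hs := Real.sqrt_pos.2 hp
    have h1 : HasDerivAt (fun r : ℝ => r ^ 2 - 4 * a ^ 2 + 4 * b ^ 2) (2 * r) r := by
      have := ((hasDerivAt_pow 2 r).sub_const (4 * a ^ 2)).add_const (4 * b ^ 2)
      simpa using this
    have h2 := ((hasDerivAt_id r).add (h1.sqrt hp.ne')).log (by simp only [id, Pi.add_apply]; positivity)
    refine h2.congr_deriv ?_
    simp only [id, Pi.add_apply]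
    set s := Real.sqrt (r ^ 2 - 4 * a ^ 2 + 4 * b ^ 2)
    have : r + s ≠ 0 := by positivity
    field_simp
    ring
  rw [intervalIntegral.integral_const_mul, intervalIntegral.integral_eq_sub_of_hasDerivAt hderiv]
  · have : Real.sqrt ((2 * a) ^ 2 - 4 * a ^ 2 + 4 * b ^ 2) = 2 * b := by
      rw [show (2 * a) ^ 2 - 4 * a ^ 2 + 4 * b ^ 2 = (2 * b) ^ 2 by ring]
      exact Real.sqrt_sq (by linarith)
    rw [this]
  · apply ContinuousOn.intervalIntegrable
    apply ContinuousOn.inv₀ (by fun_prop)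
    intro r hr
    exact (Real.sqrt_pos.2 (hpos r hr)).ne'

lemma plane_integral (a b N : ℝ) (ha : 0 ≤ a) (hb : 0 < b) (hN : 2 * a < N) :
    ∫ z in {z : ℝ × ℝ | z.1 ^ 2 + z.2 ^ 2 ≤ N ^ 2}, (DD a b z)⁻¹
    = ((2 * π * (Real.log (N + Real.sqrt (N ^ 2 - 4 * a ^ 2 + 4 * b ^ 2))
        - Real.log (2 * a + 2 * b)) : ℝ) : ℂ) := by
  have hN0 : 0 < N := by linarith
  have hSm : MeasurableSet {z : ℝ × ℝ | z.1 ^ 2 + z.2 ^ 2 ≤ N ^ 2} :=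
    measurableSet_le (by fun_prop) (by fun_prop)
  have hint : IntegrableOn (fun z => (DD a b z)⁻¹) {z : ℝ × ℝ | z.1 ^ 2 + z.2 ^ 2 ≤ N ^ 2} := by
    refine (DD_integrable a b N hb hN0).mono_set ?_
    rintro ⟨x, y⟩ h
    simp only [Set.mem_ofPred_eq] at h
    refine ⟨?_, ?_⟩
    · exact abs_le.1 (abs_le_of_sq_le_sq (by nlinarith [sq_nonneg y]) hN0.le)
    · exact abs_le.1 (abs_le_of_sq_le_sq (by nlinarith [sq_nonneg x]) hN0.le)
  set f : ℝ × ℝ → ℂ := Set.indicator {z : ℝ × ℝ | z.1 ^ 2 + z.2 ^ 2 ≤ N ^ 2}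
    (fun z => (DD a b z)⁻¹) with hf
  have hfint : Integrable f := (integrable_indicator_iff hSm).2 hint
  set F : ℝ × ℝ → ℂ := fun z =>
    (((z.1 + 2 * a * Real.cos z.2 : ℝ) : ℂ) + 2 * Complex.I * ((b * Real.sin z.2 : ℝ) : ℂ))⁻¹ with hF
  set H : ℝ × ℝ → ℂ := fun z => if z.1 ≤ N then F z else 0 with hH
  have hTm : MeasurableSet polarCoord.target := polarCoord.open_target.measurableSet
  have hfH : ∀ z ∈ polarCoord.target, z.1 • f (polarCoord.symm z) = H z := by
    rintro ⟨r, θ⟩ hz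
    have hr : 0 < r := hz.1
    have hrC : (r : ℂ) ≠ 0 := by exact_mod_cast hr.ne'
    have hsq : (r * Real.cos θ) ^ 2 + (r * Real.sin θ) ^ 2 = r ^ 2 := by
      have := Real.sin_sq_add_cos_sq θ
      linear_combination r ^ 2 * this
    simp only [hf, hH, polarCoord_symm_apply, Set.indicator, Set.mem_ofPred_eq, hsq]
    have : r ^ 2 ≤ N ^ 2 ↔ r ≤ N := by
      rw [sq_le_sq₀ hr.le hN0.le]
    simp only [this]
    split_ifs
    · simp only [DD, hF, hsq, Complex.real_smul]
      have e : ((r ^ 2 + 2 * a * (r * Real.cos θ) : ℝ) : ℂ)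
          + 2 * Complex.I * ((b * (r * Real.sin θ) : ℝ) : ℂ)
          = r * (((r + 2 * a * Real.cos θ : ℝ) : ℂ) + 2 * Complex.I * ((b * Real.sin θ : ℝ) : ℂ)) := by
        push_cast
        ring
      rw [e, mul_inv, ← mul_assoc, mul_inv_cancel₀ hrC, one_mul]
    · simp
  have hHint : IntegrableOn H polarCoord.target := by
    have h1 : IntegrableOn f (polarCoord.symm '' polarCoord.target) := hfint.integrableOn
    rw [integrableOn_image_iff_integrableOn_abs_det_fderiv_smul volume hTm
      (fun p _ => (hasFDerivAt_polarCoord_symm p).hasFDerivWithinAt) polarCoord.symm.injOn] at h1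
    refine h1.congr_fun ?_ hTm
    intro z hz
    rw [← hfH z hz]
    simp only [det_fderivPolarCoordSymm]
    rw [abs_of_pos hz.1]
  rw [← integral_indicator hSm, ← hf, ← integral_comp_polarCoord_symm,
    setIntegral_congr_fun hTm hfH]
  rw [polarCoord_target] at hHint ⊢
  rw [Measure.volume_eq_prod] at hHint ⊢
  rw [setIntegral_prod _ hHint]
  have hinner : ∀ᵐ r ∂(volume.restrict (Set.Ioi (0 : ℝ))),
      (∫ θ in Set.Ioo (-π) π, H (r, θ)) = Set.indicator (Set.Ioc (2 * a) N)
        (fun r => ((2 * π * (Real.sqrt (r ^ 2 - 4 * a ^ 2 + 4 * b ^ 2))⁻¹ : ℝ) : ℂ)) r := by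
    filter_upwards [ae_restrict_mem measurableSet_Ioi,
      ae_restrict_of_ae (Measure.ae_ne volume (2 * a))] with r hr hne
    have hr : 0 < r := hr
    rw [← integral_Ioc_eq_integral_Ioo,
      ← intervalIntegral.integral_of_le (by linarith [Real.pi_pos])]
    simp only [hH, hF]
    by_cases hrN : r ≤ N
    · simp only [hrN, if_true]
      rcases lt_or_gt_of_ne hne with h | h
      · rw [theta_small a b r hb hr h, Set.indicator_of_notMem]
        intro hh; exact absurd hh.1 (not_lt.2 h.le)
      · rw [theta_large a b r ha hb h, Set.indicator_of_mem]
        exact ⟨h, hrN⟩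
    · simp only [hrN, if_false]
      rw [Set.indicator_of_notMem]
      · simp
      · intro hh; exact hrN hh.2
  have hsub : Set.Ioc (2 * a) N ⊆ Set.Ioi 0 := by
    intro x hx
    have := hx.1
    simp only [Set.mem_Ioi]
    linarith
  rw [integral_congr_ae hinner, setIntegral_indicator measurableSet_Ioc,
    Set.inter_eq_self_of_subset_right hsub,
    ← intervalIntegral.integral_of_le hN.le, intervalIntegral.integral_ofReal,
    radial a b N ha hb hN]

lemma transfer (p q : EuclideanSpace ℝ (Fin 2)) (hq : q ≠ 0)
    (hpq : (inner ℝ p q : ℝ) = 0) (N : ℝ) (hN : 0 ≤ N) :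
    ∫ ζ in Metric.closedBall (0 : EuclideanSpace ℝ (Fin 2)) N,
                  (((‖ζ‖ ^ 2 + 2 * (inner ℝ p ζ : ℝ) : ℝ) : ℂ)
                    + 2 * Complex.I * ((inner ℝ q ζ : ℝ) : ℂ))⁻¹
    = ∫ z in {z : ℝ × ℝ | z.1 ^ 2 + z.2 ^ 2 ≤ N ^ 2}, (DD ‖p‖ ‖q‖ z)⁻¹ := by
  obtain ⟨e, he0, he1⟩ : ∃ e : OrthonormalBasis (Fin 2) ℝ (EuclideanSpace ℝ (Fin 2)),
      p = ‖p‖ • e 0 ∧ q = ‖q‖ • e 1 := by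
    have hon : Orthonormal ℝ (Set.domRestrict {i : Fin 2 | ![p, q] i ≠ 0}
        (fun i => ‖![p, q] i‖⁻¹ • ![p, q] i)) := by
      constructor
      · rintro ⟨i, hi⟩
        simp only [Set.domRestrict_apply]
        rw [norm_smul, norm_inv, norm_norm, inv_mul_cancel₀ (norm_ne_zero_iff.2 hi)]
      · rintro ⟨i, hi⟩ ⟨j, hj⟩ hij
        simp only [Set.domRestrict_apply, inner_smul_left, inner_smul_right]
        have hij : i ≠ j := fun h => hij (by simp [h])
        have hqp : (inner ℝ q p : ℝ) = 0 := by rw [real_inner_comm]; exact hpq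
        fin_cases i <;> fin_cases j <;> simp_all
    obtain ⟨e, he⟩ := hon.exists_orthonormalBasis_extension_of_card_eq (by simp)
    refine ⟨e, ?_, ?_⟩
    · by_cases hp : p = 0
      · simp [hp]
      · rw [he 0 (by simpa using hp)]
        simp [hp]
    · rw [he 1 (by simpa using hq)]
      simp [hq]
  set φ := Complex.isometryOfOrthonormal e with hφ
  have hm : MeasurePreserving (fun z : ℝ × ℝ => φ (Complex.measurableEquivRealProd.symm z)) :=
    φ.measurePreserving.comp Complex.volume_preserving_equiv_real_prod.symm
  have hem : MeasurableEmbedding (fun z : ℝ × ℝ => φ (Complex.measurableEquivRealProd.symm z)) :=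
    φ.toHomeomorph.measurableEmbedding.comp
      Complex.measurableEquivRealProd.symm.measurableEmbedding
  have hn : ∀ z : ℝ × ℝ, ‖φ (Complex.measurableEquivRealProd.symm z)‖ ^ 2 = z.1 ^ 2 + z.2 ^ 2 := by
    intro z
    rw [φ.norm_map, Complex.sq_norm, Complex.normSq_apply]
    simp [pow_two]
  rw [← hm.setIntegral_preimage_emb hem]
  have hset : (fun z : ℝ × ℝ => φ (Complex.measurableEquivRealProd.symm z)) ⁻¹'
      Metric.closedBall 0 N = {z : ℝ × ℝ | z.1 ^ 2 + z.2 ^ 2 ≤ N ^ 2} := by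
    ext z
    simp only [Set.mem_preimage, mem_closedBall_zero_iff, Set.mem_ofPred_eq, ← hn]
    rw [sq_le_sq₀ (norm_nonneg _) hN]
  rw [hset]
  congr 1
  ext z
  have o00 : (inner ℝ (e 0) (e 0) : ℝ) = 1 := by simp
  have o11 : (inner ℝ (e 1) (e 1) : ℝ) = 1 := by simp
  have o01 : (inner ℝ (e 0) (e 1) : ℝ) = 0 := e.orthonormal.2 (by decide)
  have o10 : (inner ℝ (e 1) (e 0) : ℝ) = 0 := e.orthonormal.2 (by decide)
  have i1 : (inner ℝ p (φ (Complex.measurableEquivRealProd.symm z)) : ℝ) = ‖p‖ * z.1 := by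
    conv_lhs => rw [he0]
    rw [hφ, Complex.isometryOfOrthonormal_apply, inner_smul_left, inner_add_right,
      inner_smul_right, inner_smul_right, o00, o01]
    simp
  have i2 : (inner ℝ q (φ (Complex.measurableEquivRealProd.symm z)) : ℝ) = ‖q‖ * z.2 := by
    conv_lhs => rw [he1]
    rw [hφ, Complex.isometryOfOrthonormal_apply, inner_smul_left, inner_add_right,
      inner_smul_right, inner_smul_right, o10, o11]
    simp
  rw [hn, i1, i2, DD, mul_assoc 2 ‖p‖]

/-- Let `α ≠ 0`, `p, q ∈ ℝ²` with `q ≠ 0`, `p·q = 0`, and `1 − (α/2π) ln(|p|+|q|) ≠ 0`.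
With `ε(N) := α/(1 − (α/2π) ln N)` and
`I_N := ∫_{‖ζ‖≤N} (‖ζ‖² + 2 p·ζ + 2i q·ζ)⁻¹ dζ`, one has
`lim_{N→∞} ε(N)/(1 + ε(N)·(2π)⁻²·I_N) = α/(1 − (α/2π) ln(|p|+|q|))`. -/
theorem point_potential_faddeev_coefficient_limit
    (α : ℝ) (hα : α ≠ 0) (p q : EuclideanSpace ℝ (Fin 2)) (hq : q ≠ 0)
    (hpq : (inner ℝ p q : ℝ) = 0)
    (hd : 1 - α / (2 * Real.pi) * Real.log (‖p‖ + ‖q‖) ≠ 0) :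
    Tendsto
      (fun N : ℝ =>
        ((α / (1 - α / (2 * Real.pi) * Real.log N) : ℝ) : ℂ) /
          (1 + ((α / (1 - α / (2 * Real.pi) * Real.log N) : ℝ) : ℂ)
              * (((2 * Real.pi : ℝ) : ℂ) ^ 2)⁻¹
              * ∫ ζ in Metric.closedBall (0 : EuclideanSpace ℝ (Fin 2)) N,
                  (((‖ζ‖ ^ 2 + 2 * (inner ℝ p ζ : ℝ) : ℝ) : ℂ)
                    + 2 * Complex.I * ((inner ℝ q ζ : ℝ) : ℂ))⁻¹))
      atTop
      (𝓝 ((α / (1 - α / (2 * Real.pi) * Real.log (‖p‖ + ‖q‖)) : ℝ) : ℂ)) := by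
  have hqn : 0 < ‖q‖ := norm_pos_iff.2 hq
  have hpn : 0 ≤ ‖p‖ := norm_nonneg p
  set a := ‖p‖ with ha
  set b := ‖q‖ with hb
  have hπ : (π : ℝ) ≠ 0 := Real.pi_ne_zero
  -- the ratio (N + sqrt(N^2 - 4 a^2 + 4 b^2)) / N tends to 2
  have hlim1 : Tendsto (fun N : ℝ => Real.log (N + Real.sqrt (N ^ 2 - 4 * a ^ 2 + 4 * b ^ 2))
      - Real.log N) atTop (𝓝 (Real.log 2)) := by
    have h1 : Tendsto (fun N : ℝ => 1 + Real.sqrt (1 + (4 * b ^ 2 - 4 * a ^ 2) * (N⁻¹) ^ 2))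
        atTop (𝓝 2) := by
      have h0 : Tendsto (fun N : ℝ => N⁻¹) atTop (𝓝 0) := tendsto_inv_atTop_zero
      have hc : Continuous (fun u : ℝ => 1 + Real.sqrt (1 + (4 * b ^ 2 - 4 * a ^ 2) * u ^ 2)) := by
        fun_prop
      have := (hc.tendsto 0).comp h0
      have e : (1 : ℝ) + Real.sqrt (1 + (4 * b ^ 2 - 4 * a ^ 2) * 0 ^ 2) = 2 := by
        norm_num
      rw [e] at this
      exact this
    have h2 := h1.log (by norm_num)
    refine h2.congr' ?_
    filter_upwards [eventually_gt_atTop 0] with N hN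
    rw [← Real.log_div (by positivity) hN.ne']
    congr 1
    have e : N ^ 2 - 4 * a ^ 2 + 4 * b ^ 2
        = N ^ 2 * (1 + (4 * b ^ 2 - 4 * a ^ 2) * (N⁻¹) ^ 2) := by
      field_simp
      ring
    rw [e, Real.sqrt_mul (by positivity), Real.sqrt_sq hN.le]
    field_simp
  have hlog : Real.log (2 * a + 2 * b) = Real.log 2 + Real.log (a + b) := by
    rw [← mul_add, Real.log_mul (by norm_num) (by positivity)]
  -- real limit
  have hden : Tendsto (fun N : ℝ => 1 + α / (2 * π) *
      ((Real.log (N + Real.sqrt (N ^ 2 - 4 * a ^ 2 + 4 * b ^ 2)) - Real.log N)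
        - Real.log (2 * a + 2 * b))) atTop
      (𝓝 (1 - α / (2 * π) * Real.log (a + b))) := by
    have := ((hlim1.sub_const (Real.log (2 * a + 2 * b))).const_mul (α / (2 * π))).const_add 1
    convert this using 2
    rw [hlog]
    ring
  have hmain := (tendsto_const_nhds (x := α)).div hden hd
  have hmainC := (Complex.continuous_ofReal.tendsto _).comp hmain
  refine hmainC.congr' ?_
  have hne : ∀ᶠ N : ℝ in atTop, 1 - α / (2 * π) * Real.log N ≠ 0 := by
    filter_upwards [Real.tendsto_log_atTop.eventually_gt_atTop (2 * π / α)] with N hN h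
    have : Real.log N = 2 * π / α := by
      field_simp at h ⊢
      linarith
    linarith
  filter_upwards [hne, eventually_gt_atTop 0, eventually_gt_atTop (2 * a)] with N hN hN0 hNa
  rw [transfer p q hq hpq N hN0.le, plane_integral a b N hpn hqn hNa]
  simp only [Function.comp_apply, Pi.div_apply]
  rw [← Complex.ofReal_pow, ← Complex.ofReal_inv, ← Complex.ofReal_mul, ← Complex.ofReal_mul,
    ← Complex.ofReal_one, ← Complex.ofReal_add, ← Complex.ofReal_div, Complex.ofReal_inj]
  generalize Real.log (N + Real.sqrt (N ^ 2 - 4 * a ^ 2 + 4 * b ^ 2)) = L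
  generalize Real.log (2 * a + 2 * b) = K
  set E := 1 - α / (2 * π) * Real.log N with hE
  have e : 1 + α / (2 * π) * (L - Real.log N - K)
      = E * (1 + α / E * ((2 * π) ^ 2)⁻¹ * (2 * π * (L - K))) := by
    have : E * (1 + α / E * ((2 * π) ^ 2)⁻¹ * (2 * π * (L - K)))
      = E + α * ((2 * π) ^ 2)⁻¹ * (2 * π * (L - K)) := by
      field_simp
    rw [this, hE]
    field_simp
    ring
  rw [e, div_mul_eq_div_div]
end

section
/- Let p, q ∈ ℝ² with q ≠ 0 and p·q = 0, and let x ∈ ℝ², x ≠ 0. Then the limit lim_{N→∞} ∫_{‖ξ‖≤N} e^{i x·ξ}·(‖ξ‖² + 2 p·ξ + 2i q·ξ)⁻¹ dξ exists in ℂ (the integrand being Lebesgue integrable on each disc {‖ξ‖ ≤ N}). -/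
open MeasureTheory Real Filter Topology


lemma abs_rpow_intervalIntegrable (r : ℝ) (hr : -1 < r) (a b : ℝ) :
    IntervalIntegrable (fun t : ℝ => |t| ^ r) volume a b := by
  have pos : ∀ c : ℝ, 0 ≤ c → IntervalIntegrable (fun t : ℝ => |t| ^ r) volume 0 c := by
    intro c hc
    have h := intervalIntegral.intervalIntegrable_rpow' (a := 0) (b := c) hr
    refine h.congr ?_
    intro t ht
    rw [Set.uIoc_of_le hc] at ht
    simp only [abs_of_pos ht.1]
  have all : ∀ c : ℝ, IntervalIntegrable (fun t : ℝ => |t| ^ r) volume 0 c := by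
    intro c
    rcases le_total 0 c with hc | hc
    · exact pos c hc
    · have h := (IntervalIntegrable.iff_comp_neg (by simp)).1 (pos (-c) (by linarith))
      simpa using h
  exact (all a).symm.trans (all b)

lemma abs_add_rpow_integrableOn (r : ℝ) (hr : -1 < r) (s N : ℝ) :
    IntegrableOn (fun t : ℝ => |t + s| ^ r) (Set.Icc (-N) N) := by
  rcases le_total (-N) N with h | h
  · have := (abs_rpow_intervalIntegrable r hr (-N + s) (N + s)).comp_add_right s
    simp only [add_sub_cancel_right] at this
    rw [integrableOn_Icc_iff_integrableOn_Ioc]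
    exact (intervalIntegrable_iff_integrableOn_Ioc_of_le h).1 this
  · rcases h.eq_or_lt with h | h
    · rw [← h]; simp
    · rw [Set.Icc_eq_empty (by linarith)]; simp

lemma bound_aux (X Y Z A m K : ℝ) (hX : 0 < X) (hY : 0 < Y) (hZ : 0 < Z) (hm : 0 < m) (hK : 0 < K)
    (h1 : m * X ≤ A) (h2 : Y * Z ≤ K * A) :
    A⁻¹ ≤ (m ^ (-(3/4) : ℝ) * K ^ (1/4 : ℝ)) *
      (X ^ (-(3/4) : ℝ) * (Y ^ (-(1/2) : ℝ) + Z ^ (-(1/2) : ℝ))) := by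
  have hA : 0 < A := lt_of_lt_of_le (by positivity) h1
  have e1 : A⁻¹ = A ^ (-(3/4) : ℝ) * A ^ (-(1/4) : ℝ) := by
    rw [← Real.rpow_add hA, ← Real.rpow_neg_one]; norm_num
  have b1 : A ^ (-(3/4) : ℝ) ≤ m ^ (-(3/4) : ℝ) * X ^ (-(3/4) : ℝ) := by
    rw [← Real.mul_rpow hm.le hX.le]
    exact Real.rpow_le_rpow_of_nonpos (by positivity) h1 (by norm_num)
  have b2 : A ^ (-(1/4) : ℝ) ≤ K ^ (1/4 : ℝ) * (Y ^ (-(1/4) : ℝ) * Z ^ (-(1/4) : ℝ)) := by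
    have : (K * A) ^ (-(1/4) : ℝ) ≤ (Y * Z) ^ (-(1/4) : ℝ) :=
      Real.rpow_le_rpow_of_nonpos (by positivity) h2 (by norm_num)
    rw [Real.mul_rpow hK.le hA.le, Real.mul_rpow hY.le hZ.le] at this
    have hk : K ^ (1/4 : ℝ) * K ^ (-(1/4) : ℝ) = 1 := by
      rw [← Real.rpow_add hK]; norm_num
    calc A ^ (-(1/4) : ℝ) = K ^ (1/4 : ℝ) * (K ^ (-(1/4) : ℝ) * A ^ (-(1/4) : ℝ)) := by
          rw [← mul_assoc, hk, one_mul]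
      _ ≤ _ := by gcongr
  have sq : ∀ T : ℝ, 0 < T → T ^ (-(1/2) : ℝ) = (T ^ (-(1/4) : ℝ)) ^ 2 := by
    intro T hT
    rw [← Real.rpow_natCast, ← Real.rpow_mul hT.le]; norm_num
  have b3 : Y ^ (-(1/4) : ℝ) * Z ^ (-(1/4) : ℝ) ≤ Y ^ (-(1/2) : ℝ) + Z ^ (-(1/2) : ℝ) := by
    rw [sq Y hY, sq Z hZ]
    nlinarith [sq_nonneg (Y ^ (-(1/4) : ℝ) - Z ^ (-(1/4) : ℝ)), sq_nonneg (Y ^ (-(1/4) : ℝ)),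
      sq_nonneg (Z ^ (-(1/4) : ℝ))]
  calc A⁻¹ = A ^ (-(3/4) : ℝ) * A ^ (-(1/4) : ℝ) := e1
    _ ≤ (m ^ (-(3/4) : ℝ) * X ^ (-(3/4) : ℝ)) *
        (K ^ (1/4 : ℝ) * (Y ^ (-(1/2) : ℝ) + Z ^ (-(1/2) : ℝ))) := by
        have b4 := b2.trans (mul_le_mul_of_nonneg_left b3 (by positivity : 0 ≤ K ^ (1/4 : ℝ)))
        gcongr
    _ = _ := by ring

lemma coord_integrable (a c N : ℝ) (hc : 0 < c) (hN : 0 ≤ N) :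
    IntegrableOn (fun w : Fin 2 → ℝ =>
      (((w 0 ^ 2 + w 1 ^ 2 + 2 * (a * w 1) : ℝ) : ℂ) + 2 * Complex.I * ((c * w 0 : ℝ) : ℂ))⁻¹)
      {w | |w 0| ≤ N ∧ |w 1| ≤ N} := by
  set K : ℝ := 1 + N / (2 * c) with hK
  have hKpos : 0 < K := by positivity
  let f : Fin 2 → ℝ → ℝ := ![fun t => (Set.Icc (-N) N).indicator (fun t => |t + 0| ^ (-(3/4) : ℝ)) t,
    fun t => (Set.Icc (-N) N).indicator
      (fun t => |t + 0| ^ (-(1/2) : ℝ) + |t + 2 * a| ^ (-(1/2) : ℝ)) t]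
  have hf : ∀ i, Integrable (f i) := by
    intro i
    fin_cases i
    · exact (abs_add_rpow_integrableOn _ (by norm_num) _ _).integrable_indicator measurableSet_Icc
    · exact ((abs_add_rpow_integrableOn _ (by norm_num) _ _).add
        (abs_add_rpow_integrableOn _ (by norm_num) _ _)).integrable_indicator measurableSet_Icc
  have hprod : Integrable (fun w : Fin 2 → ℝ => ∏ i, f i (w i)) := Integrable.fintype_prod hf
  have hS : MeasurableSet {w : Fin 2 → ℝ | |w 0| ≤ N ∧ |w 1| ≤ N} := by
    have m0 : MeasurableSet {w : Fin 2 → ℝ | |w 0| ≤ N} :=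
      measurableSet_le (by fun_prop) (by fun_prop)
    have m1 : MeasurableSet {w : Fin 2 → ℝ | |w 1| ≤ N} :=
      measurableSet_le (by fun_prop) (by fun_prop)
    exact m0.inter m1
  refine Integrable.mono' (hprod.integrableOn.const_mul
    ((2 * c) ^ (-(3/4) : ℝ) * K ^ (1/4 : ℝ))) ?_ ?_
  · apply Measurable.aestronglyMeasurable
    fun_prop
  · rw [ae_restrict_iff' hS]
    have n0 : ∀ᵐ w : Fin 2 → ℝ, w 0 ≠ 0 := Measure.ae_eval_ne (fun _ => volume) 0 0
    have n1 : ∀ᵐ w : Fin 2 → ℝ, w 1 ≠ 0 := Measure.ae_eval_ne (fun _ => volume) 1 0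
    have n2 : ∀ᵐ w : Fin 2 → ℝ, w 1 ≠ -(2 * a) := Measure.ae_eval_ne (fun _ => volume) 1 _
    filter_upwards [n0, n1, n2] with w h0 h1 h2 ⟨hw0, hw1⟩
    have hi0 : w 0 ∈ Set.Icc (-N) N := abs_le.1 hw0
    have hi1 : w 1 ∈ Set.Icc (-N) N := abs_le.1 hw1
    have hfw : ∏ i, f i (w i) = |w 0| ^ (-(3/4) : ℝ) *
        (|w 1| ^ (-(1/2) : ℝ) + |w 1 + 2 * a| ^ (-(1/2) : ℝ)) := by
      simp [f, Fin.prod_univ_two, hi0, hi1]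
    rw [hfw, norm_inv]
    set z : ℂ := (((w 0 ^ 2 + w 1 ^ 2 + 2 * (a * w 1) : ℝ) : ℂ) + 2 * Complex.I * ((c * w 0 : ℝ) : ℂ)) with hz
    have hre : z.re = w 0 ^ 2 + w 1 ^ 2 + 2 * (a * w 1) := by
      simp only [hz, Complex.add_re, Complex.ofReal_re, Complex.mul_re, Complex.mul_im, Complex.I_re, Complex.I_im, Complex.ofReal_im]
      simp
    have him : z.im = 2 * c * w 0 := by
      simp only [hz, Complex.add_im, Complex.ofReal_re, Complex.mul_re, Complex.mul_im, Complex.I_re, Complex.I_im, Complex.ofReal_im]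
      simp; ring
    have ha1 : 2 * c * |w 0| ≤ ‖z‖ := by
      have := Complex.abs_im_le_norm z
      rwa [him, abs_mul, abs_of_pos (by positivity : 0 < 2 * c)] at this
    refine bound_aux _ _ _ _ _ _ (abs_pos.2 h0) (abs_pos.2 h1)
      (abs_pos.2 (fun h => h2 (by linarith))) (by positivity) hKpos ha1 ?_
    rw [← abs_mul]
    have hr := Complex.abs_re_le_norm z
    rw [hre] at hr
    have e : w 1 * (w 1 + 2 * a) = (w 0 ^ 2 + w 1 ^ 2 + 2 * (a * w 1)) - w 0 ^ 2 := by ring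
    have h3 : w 0 ^ 2 ≤ N / (2 * c) * ‖z‖ := by
      rw [← sq_abs]
      calc |w 0| ^ 2 = |w 0| * |w 0| := sq _
        _ ≤ N * |w 0| := by gcongr
        _ = N / (2 * c) * (2 * c * |w 0|) := by field_simp
        _ ≤ _ := by gcongr
    calc |w 1 * (w 1 + 2 * a)| ≤ |w 0 ^ 2 + w 1 ^ 2 + 2 * (a * w 1)| + |w 0 ^ 2| := by
          rw [e]; exact abs_sub _ _
      _ ≤ ‖z‖ + N / (2 * c) * ‖z‖ := by
          rw [abs_of_nonneg (sq_nonneg (w 0))]; gcongr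
      _ = K * ‖z‖ := by rw [hK]; ring

lemma symbol_integrable (p q : EuclideanSpace ℝ (Fin 2)) (hq : q ≠ 0)
    (hpq : (inner ℝ p q : ℝ) = 0) (N : ℝ) :
    IntegrableOn (fun ξ : EuclideanSpace ℝ (Fin 2) =>
       (((‖ξ‖ ^ 2 + 2 * (inner ℝ p ξ : ℝ) : ℝ) : ℂ)
              + 2 * Complex.I * ((inner ℝ q ξ : ℝ) : ℂ))⁻¹) (Metric.closedBall 0 N) := by
  rcases lt_or_ge N 0 with hN | hN
  · rw [Metric.closedBall_eq_empty.2 hN]; simp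
  have hqn : 0 < ‖q‖ := norm_pos_iff.2 hq
  obtain ⟨b, hb⟩ : ∃ b : OrthonormalBasis (Fin 2) ℝ (EuclideanSpace ℝ (Fin 2)),
      ∀ i ∈ ({0} : Set (Fin 2)), b i = (fun _ => ‖q‖⁻¹ • q : Fin 2 → EuclideanSpace ℝ (Fin 2)) i := by
    apply Orthonormal.exists_orthonormalBasis_extension_of_card_eq
    · simp
    · constructor
      · intro i
        simp [norm_smul, hqn.ne']
      · intro i j hij
        exact absurd (Subsingleton.elim i j) hij
  have hb0 : b 0 = ‖q‖⁻¹ • q := hb 0 rfl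
  have hqb : q = ‖q‖ • b 0 := by rw [hb0, smul_smul, mul_inv_cancel₀ hqn.ne', one_smul]
  have hpb0 : (inner ℝ p (b 0) : ℝ) = 0 := by rw [hb0, inner_smul_right, hpq, mul_zero]
  set a : ℝ := inner ℝ p (b 1) with ha
  have hpi : ∀ ξ, (inner ℝ p ξ : ℝ) = a * b.repr ξ 1 := by
    intro ξ
    rw [← b.sum_inner_mul_inner p ξ, Fin.sum_univ_two, hpb0, zero_mul, zero_add, b.repr_apply_apply]
  have hqi : ∀ ξ, (inner ℝ q ξ : ℝ) = ‖q‖ * b.repr ξ 0 := by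
    intro ξ
    conv_lhs => rw [hqb]
    rw [inner_smul_left, b.repr_apply_apply]; simp
  have hni : ∀ ξ, ‖ξ‖ ^ 2 = b.repr ξ 0 ^ 2 + b.repr ξ 1 ^ 2 := by
    intro ξ
    rw [← b.repr.norm_map ξ, EuclideanSpace.norm_sq_eq, Fin.sum_univ_two]; simp
  have hmp : MeasurePreserving (fun ξ : EuclideanSpace ℝ (Fin 2) => (WithLp.ofLp (b.repr ξ) : Fin 2 → ℝ)) :=
    (PiLp.volume_preserving_ofLp (Fin 2)).comp b.measurePreserving_repr
  have hS : MeasurableSet {w : Fin 2 → ℝ | |w 0| ≤ N ∧ |w 1| ≤ N} := by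
    have m0 : MeasurableSet {w : Fin 2 → ℝ | |w 0| ≤ N} :=
      measurableSet_le (by fun_prop) (by fun_prop)
    have m1 : MeasurableSet {w : Fin 2 → ℝ | |w 1| ≤ N} :=
      measurableSet_le (by fun_prop) (by fun_prop)
    exact m0.inter m1
  have h1 := hmp.integrable_comp_of_integrable
    ((coord_integrable a ‖q‖ N hqn hN).integrable_indicator hS)
  refine (h1.integrableOn (s := Metric.closedBall 0 N)).congr_fun ?_ measurableSet_closedBall
  intro ξ hξ
  have hξ' : ‖ξ‖ ≤ N := by simpa using hξ
  have hmem : (WithLp.ofLp (b.repr ξ) : Fin 2 → ℝ) ∈ {w : Fin 2 → ℝ | |w 0| ≤ N ∧ |w 1| ≤ N} := by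
    have h := hni ξ
    have hle : ‖ξ‖ ^ 2 ≤ N ^ 2 := by gcongr
    constructor
    · apply abs_le_of_sq_le_sq _ hN
      nlinarith [sq_nonneg (b.repr ξ 1)]
    · apply abs_le_of_sq_le_sq _ hN
      nlinarith [sq_nonneg (b.repr ξ 0)]
  simp only [Function.comp]
  rw [Set.indicator_of_mem hmem, hpi, hqi, hni]

lemma jap_int : Integrable (fun ξ : EuclideanSpace ℝ (Fin 2) => ((1 + ‖ξ‖) ^ 3)⁻¹) := by
  have h := integrable_one_add_norm (E := EuclideanSpace ℝ (Fin 2)) (μ := volume) (r := 3)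
    (by simp; norm_num)
  refine h.congr (Eventually.of_forall fun ξ => ?_)
  simp only
  rw [Real.rpow_neg (by positivity)]
  norm_cast

/-- if `f` is integrable then its integrals over discs converge -/
lemma disc_tendsto (f : EuclideanSpace ℝ (Fin 2) → ℂ) (hf : Integrable f) :
    Tendsto (fun N : ℝ => ∫ ξ in Metric.closedBall (0 : EuclideanSpace ℝ (Fin 2)) N, f ξ) atTop
      (𝓝 (∫ ξ, f ξ)) :=
  (aecover_closedBall tendsto_id).integral_tendsto_of_countably_generated hf

lemma shift_diff_bound (ξ η : EuclideanSpace ℝ (Fin 2)) :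
    |(1 + ‖ξ‖ ^ 2)⁻¹ - (1 + ‖ξ + η‖ ^ 2)⁻¹| ≤
      (8 * (2 + 2 * ‖η‖ ^ 2) * (‖η‖ * (2 + ‖η‖))) * ((1 + ‖ξ‖) ^ 3)⁻¹ := by
  set s := ‖ξ‖ with hs
  set t := ‖ξ + η‖ with ht
  set e := ‖η‖ with he
  have hs0 : 0 ≤ s := norm_nonneg _
  have ht0 : 0 ≤ t := norm_nonneg _
  have he0 : 0 ≤ e := norm_nonneg _
  have h1 : t ≤ s + e := norm_add_le _ _
  have h2 : s ≤ t + e := by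
    have := norm_sub_le (ξ + η) η
    simpa using this
  have hd : |t - s| ≤ e := abs_le.2 ⟨by linarith, by linarith⟩
  have hn : |t ^ 2 - s ^ 2| ≤ e * (2 + e) * (1 + s) := by
    have : t ^ 2 - s ^ 2 = (t - s) * (t + s) := by ring
    rw [this, abs_mul, abs_of_nonneg (by positivity : 0 ≤ t + s), mul_assoc]
    gcongr
    nlinarith
  have hA : 1 + s ^ 2 ≤ (2 + 2 * e ^ 2) * (1 + t ^ 2) := by
    nlinarith [sq_nonneg (t - e), mul_nonneg (sq_nonneg e) (sq_nonneg t), mul_self_le_mul_self hs0 h2]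
  have hB : (1 + s) ^ 2 ≤ 2 * (1 + s ^ 2) := by nlinarith [sq_nonneg (1 - s)]
  have heq : (1 + s ^ 2)⁻¹ - (1 + t ^ 2)⁻¹ = (t ^ 2 - s ^ 2) / ((1 + s ^ 2) * (1 + t ^ 2)) := by
    field_simp; ring
  rw [heq, abs_div, abs_of_pos (by positivity : 0 < (1 + s ^ 2) * (1 + t ^ 2)),
    div_le_iff₀ (by positivity)]
  have hC : (1 + s) ^ 4 ≤ 4 * (2 + 2 * e ^ 2) * ((1 + s ^ 2) * (1 + t ^ 2)) := by
    calc (1 + s) ^ 4 = ((1 + s) ^ 2) * ((1 + s) ^ 2) := by ring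
      _ ≤ (2 * (1 + s ^ 2)) * (2 * ((2 + 2 * e ^ 2) * (1 + t ^ 2))) := by
          gcongr
          linarith
      _ = _ := by ring
  calc |t ^ 2 - s ^ 2| ≤ e * (2 + e) * (1 + s) := hn
    _ = e * (2 + e) * ((1 + s) ^ 3)⁻¹ * (1 + s) ^ 4 := by field_simp
    _ ≤ e * (2 + e) * ((1 + s) ^ 3)⁻¹ * (4 * (2 + 2 * e ^ 2) * ((1 + s ^ 2) * (1 + t ^ 2))) := by
        gcongr
    _ ≤ 2 * (e * (2 + e) * ((1 + s) ^ 3)⁻¹ * (4 * (2 + 2 * e ^ 2) * ((1 + s ^ 2) * (1 + t ^ 2)))) :=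
        le_mul_of_one_le_left (by positivity) (by norm_num)
    _ = _ := by ring

lemma base_limit (x : EuclideanSpace ℝ (Fin 2)) (hx : x ≠ 0) :
    ∃ L : ℂ, Tendsto (fun N : ℝ => ∫ ξ in Metric.closedBall (0 : EuclideanSpace ℝ (Fin 2)) N,
        Complex.exp (Complex.I * ((inner ℝ x ξ : ℝ) : ℂ)) * (((1 + ‖ξ‖ ^ 2)⁻¹ : ℝ) : ℂ))
      atTop (𝓝 L) := by
  have hxn : 0 < ‖x‖ := norm_pos_iff.2 hx
  set η : EuclideanSpace ℝ (Fin 2) := (π / ‖x‖ ^ 2) • x with hη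
  have hxη : (inner ℝ x η : ℝ) = π := by
    rw [hη, inner_smul_right, real_inner_self_eq_norm_sq]; field_simp
  set e : EuclideanSpace ℝ (Fin 2) → ℂ := fun ξ => Complex.exp (Complex.I * ((inner ℝ x ξ : ℝ) : ℂ)) with he
  have hen : ∀ ξ, ‖e ξ‖ = 1 := fun ξ => by
    simp only [he]; rw [mul_comm]; exact Complex.norm_exp_ofReal_mul_I _
  have hec : Continuous e := by simp only [he]; fun_prop
  have hes : ∀ ξ, e (ξ + η) = - e ξ := fun ξ => by
    simp only [he]
    rw [inner_add_right, hxη]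
    push_cast
    rw [mul_add, Complex.exp_add, mul_comm Complex.I (π : ℂ), Complex.exp_pi_mul_I]; ring
  set h : EuclideanSpace ℝ (Fin 2) → ℂ := fun ξ => (((1 + ‖ξ‖ ^ 2)⁻¹ : ℝ) : ℂ) with hh
  have hhc : Continuous h := by
    simp only [hh]
    refine Complex.continuous_ofReal.comp (Continuous.inv₀ (by fun_prop) fun ξ => by positivity)
  set k : EuclideanSpace ℝ (Fin 2) → ℂ := fun ξ => h (ξ + η) with hk
  have hkc : Continuous k := by simp only [hk]; fun_prop
  have hint : ∀ (f : EuclideanSpace ℝ (Fin 2) → ℂ), Continuous f → ∀ c N,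
      IntegrableOn f (Metric.closedBall c N) := fun f hf c N =>
    hf.continuousOn.integrableOn_compact (isCompact_closedBall c N)
  have hkcm : Continuous (fun ξ => e ξ * k ξ) := hec.mul hkc
  have hhcm : Continuous (fun ξ => e ξ * h ξ) := hec.mul hhc
  -- the shifted integral
  have hshift : ∀ N, ∫ ξ in Metric.closedBall (0 : EuclideanSpace ℝ (Fin 2)) N, e ξ * h ξ =
      - ∫ ξ in Metric.closedBall (-η) N, e ξ * k ξ := by
    intro N
    have := (measurePreserving_add_right (volume : Measure (EuclideanSpace ℝ (Fin 2))) η).setIntegral_preimage_emb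
      (measurableEmbedding_addRight η) (fun ξ => e ξ * h ξ) (Metric.closedBall 0 N)
    rw [← this, ← integral_neg]
    have hpre : (fun ξ => ξ + η) ⁻¹' Metric.closedBall 0 N = Metric.closedBall (-η) N := by
      ext ξ; simp [dist_eq_norm]
    rw [hpre]
    congr 1
    ext ξ
    simp only [hes, hk]; ring
  -- main term
  have hD : Integrable (fun ξ => e ξ * (h ξ - k ξ)) := by
    refine Integrable.mono' (jap_int.const_mul (8 * (2 + 2 * ‖η‖ ^ 2) * (‖η‖ * (2 + ‖η‖)))) ?_ ?_
    · exact (hec.mul (hhc.sub hkc)).aestronglyMeasurable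
    · refine Eventually.of_forall fun ξ => ?_
      rw [norm_mul, hen, one_mul]
      simp only [hh, hk]
      rw [← Complex.ofReal_sub, Complex.norm_real]
      exact shift_diff_bound ξ η
  set V : ℝ := (volume : Measure (EuclideanSpace ℝ (Fin 2))).real (Metric.closedBall 0 1) with hV
  have hvol : ∀ (c : EuclideanSpace ℝ (Fin 2)) (N : ℝ), 0 ≤ N → volume.real (Metric.closedBall c N) = N ^ 2 * V := by
    intro c N hN
    rw [Measure.addHaar_real_closedBall' _ _ hN]; simp [hV]
  set d := ‖η‖ with hd
  have hd0 : 0 ≤ d := norm_nonneg _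
  -- error estimate
  have hann : ∀ (c : EuclideanSpace ℝ (Fin 2)), ‖c‖ ≤ d → ∀ N : ℝ, 2 * d ≤ N →
      ‖(∫ ξ in Metric.closedBall c N, e ξ * k ξ) - ∫ ξ in Metric.closedBall 0 (N - d), e ξ * k ξ‖
        ≤ (1 + (N - 2 * d) ^ 2)⁻¹ * ((N ^ 2 - (N - d) ^ 2) * V) := by
    intro c hc N hN
    have hsub : Metric.closedBall 0 (N - d) ⊆ Metric.closedBall c N :=
      Metric.closedBall_subset_closedBall' (by rw [dist_zero_left]; linarith)
    rw [← setIntegral_sdiff measurableSet_closedBall (hint _ hkcm c N) hsub]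
    have hm : volume.real (Metric.closedBall c N \ Metric.closedBall 0 (N - d)) = (N ^ 2 - (N - d) ^ 2) * V := by
      rw [measureReal_sdiff hsub measurableSet_closedBall measure_closedBall_lt_top.ne, hvol _ _ (by linarith), hvol _ _ (by linarith)]
      ring
    rw [← hm]
    apply norm_setIntegral_le_of_norm_le_const
    · exact (measure_mono Set.sdiff_subset).trans_lt measure_closedBall_lt_top
    · rintro ξ ⟨-, hξ⟩
      rw [norm_mul, hen, one_mul]
      simp only [hk, hh]
      rw [Complex.norm_real, Real.norm_of_nonneg (by positivity)]
      have hξ' : N - d < ‖ξ‖ := by simpa using hξ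
      have : ‖ξ‖ ≤ ‖ξ + η‖ + d := by
        have := norm_sub_le (ξ + η) η
        simpa using this
      have h0 : 0 ≤ N - 2 * d := by linarith
      have h1 : N - 2 * d ≤ ‖ξ + η‖ := by linarith
      gcongr
  have hlim0 : Tendsto (fun N : ℝ => 2 * ((1 + (N - 2 * d) ^ 2)⁻¹ * ((N ^ 2 - (N - d) ^ 2) * V)))
      atTop (𝓝 0) := by
    have hbd : Tendsto (fun N : ℝ => (16 * d * V) / N) atTop (𝓝 0) :=
      tendsto_const_nhds.div_atTop tendsto_id
    have hV0 : 0 ≤ V := measureReal_nonneg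
    refine squeeze_zero' ?_ ?_ hbd
    · filter_upwards [eventually_ge_atTop (4 * d + 1)] with N hN
      have : 0 ≤ N ^ 2 - (N - d) ^ 2 := by nlinarith
      positivity
    · filter_upwards [eventually_ge_atTop (4 * d + 1)] with N hN
      have hN0 : 0 < N := by linarith
      have h1 : (1 + (N - 2 * d) ^ 2)⁻¹ ≤ 4 / N ^ 2 := by
        rw [inv_le_comm₀ (by positivity) (by positivity), inv_div, div_le_iff₀ (by norm_num)]
        nlinarith
      have h2 : N ^ 2 - (N - d) ^ 2 ≤ 2 * d * N := by nlinarith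
      calc 2 * ((1 + (N - 2 * d) ^ 2)⁻¹ * ((N ^ 2 - (N - d) ^ 2) * V))
          ≤ 2 * ((1 + (N - 2 * d) ^ 2)⁻¹ * ((2 * d * N) * V)) := by gcongr
        _ ≤ 2 * (4 / N ^ 2 * ((2 * d * N) * V)) := by gcongr
        _ = 16 * d * V / N := by field_simp; ring
  have herr : Tendsto (fun N : ℝ => (∫ ξ in Metric.closedBall 0 N, e ξ * k ξ) -
      ∫ ξ in Metric.closedBall (-η) N, e ξ * k ξ) atTop (𝓝 0) := by
    apply squeeze_zero_norm' _ hlim0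
    filter_upwards [eventually_ge_atTop (2 * d)] with N hN
    have h1 := hann 0 (by simpa using hd0) N hN
    have h2 := hann (-η) (by simp [hd]) N hN
    set A := ∫ ξ in Metric.closedBall 0 (N - d), e ξ * k ξ
    calc _ = ‖((∫ ξ in Metric.closedBall 0 N, e ξ * k ξ) - A) -
          ((∫ ξ in Metric.closedBall (-η) N, e ξ * k ξ) - A)‖ := by congr 1; ring
      _ ≤ _ := norm_sub_le _ _
      _ ≤ _ := by linarith
  have hfin := ((disc_tendsto _ hD).add herr).const_mul (1 / 2 : ℂ)
  refine ⟨_, hfin.congr fun N => ?_⟩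
  have e1 : ∫ ξ in Metric.closedBall 0 N, e ξ * (h ξ - k ξ) =
      (∫ ξ in Metric.closedBall 0 N, e ξ * h ξ) - ∫ ξ in Metric.closedBall 0 N, e ξ * k ξ := by
    rw [← integral_sub (hint _ hhcm 0 N) (hint _ hkcm 0 N)]
    congr 1; ext ξ; ring
  rw [e1]
  have := hshift N
  linear_combination (-1/2 : ℂ) * this

lemma remainder_bound (p q ξ : EuclideanSpace ℝ (Fin 2)) (hξ : 4 * ‖p‖ + 1 ≤ ‖ξ‖) :
    ‖(((‖ξ‖ ^ 2 + 2 * (inner ℝ p ξ : ℝ) : ℝ) : ℂ) + 2 * Complex.I * ((inner ℝ q ξ : ℝ) : ℂ))⁻¹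
      - (((1 + ‖ξ‖ ^ 2)⁻¹ : ℝ) : ℂ)‖ ≤ (16 * (1 + 2 * ‖p‖ + 2 * ‖q‖)) * ((1 + ‖ξ‖) ^ 3)⁻¹ := by
  set z : ℂ := ((‖ξ‖ ^ 2 + 2 * (inner ℝ p ξ : ℝ) : ℝ) : ℂ) + 2 * Complex.I * ((inner ℝ q ξ : ℝ) : ℂ)
    with hz
  have hp := abs_real_inner_le_norm p ξ
  have hq := abs_real_inner_le_norm q ξ
  have hp0 := norm_nonneg p
  have hq0 := norm_nonneg q
  have hre : z.re = ‖ξ‖ ^ 2 + 2 * (inner ℝ p ξ : ℝ) := by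
    simp only [hz, Complex.add_re, Complex.ofReal_re, Complex.mul_re, Complex.mul_im, Complex.I_re,
      Complex.I_im, Complex.ofReal_im]
    simp
  have hnum : ‖((1 + ‖ξ‖ ^ 2 : ℝ) : ℂ) - z‖ ≤ (1 + 2 * ‖p‖ + 2 * ‖q‖) * (1 + ‖ξ‖) := by
    have e : ((1 + ‖ξ‖ ^ 2 : ℝ) : ℂ) - z = ((1 - 2 * (inner ℝ p ξ : ℝ) : ℝ) : ℂ)
        - 2 * Complex.I * ((inner ℝ q ξ : ℝ) : ℂ) := by
      rw [hz]; push_cast; ring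
    have n1 : ‖((1 - 2 * (inner ℝ p ξ : ℝ) : ℝ) : ℂ)‖ ≤ 1 + 2 * (‖p‖ * ‖ξ‖) := by
      rw [Complex.norm_real, Real.norm_eq_abs]
      rw [abs_le] at hp ⊢
      constructor <;> linarith [hp.1, hp.2]
    have n2 : ‖2 * Complex.I * ((inner ℝ q ξ : ℝ) : ℂ)‖ ≤ 2 * (‖q‖ * ‖ξ‖) := by
      rw [norm_mul, norm_mul, Complex.norm_real, Complex.norm_I, Real.norm_eq_abs]
      simpa using hq
    rw [e]
    refine (norm_sub_le _ _).trans ((add_le_add n1 n2).trans ?_)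
    nlinarith [norm_nonneg ξ]
  set s := ‖ξ‖ with hs
  have hs1 : 1 ≤ s := by linarith
  have hzn : s ^ 2 / 2 ≤ ‖z‖ := by
    have h1 := (le_abs_self _).trans (Complex.abs_re_le_norm z)
    rw [hre] at h1
    have h2 := (abs_le.1 hp).1
    nlinarith
  have hz4 : (1 + s) ^ 2 / 8 ≤ ‖z‖ := by nlinarith
  have hzpos : 0 < ‖z‖ := lt_of_lt_of_le (by positivity) hz4
  have hz0 : z ≠ 0 := norm_pos_iff.1 hzpos
  have hw0 : ((1 + s ^ 2 : ℝ) : ℂ) ≠ 0 := by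
    rw [Complex.ofReal_ne_zero]; positivity
  have heq : z⁻¹ - (((1 + s ^ 2)⁻¹ : ℝ) : ℂ) = (((1 + s ^ 2 : ℝ) : ℂ) - z) / (z * ((1 + s ^ 2 : ℝ) : ℂ)) := by
    rw [Complex.ofReal_inv]
    field_simp
  rw [heq, norm_div, norm_mul, Complex.norm_real, Real.norm_of_nonneg (by positivity : 0 ≤ 1 + s ^ 2),
    div_le_iff₀ (by positivity)]
  have hB : (1 + s) ^ 2 / 2 ≤ 1 + s ^ 2 := by nlinarith [sq_nonneg (1 - s)]
  calc _ ≤ (1 + 2 * ‖p‖ + 2 * ‖q‖) * (1 + s) := hnum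
    _ = 16 * (1 + 2 * ‖p‖ + 2 * ‖q‖) * ((1 + s) ^ 3)⁻¹ * ((1 + s) ^ 2 / 8 * ((1 + s) ^ 2 / 2)) := by
        field_simp; norm_num
    _ ≤ _ := by gcongr

/-- Let `p, q ∈ ℝ²` with `q ≠ 0`, `p·q = 0`, and `x ∈ ℝ²`, `x ≠ 0`. Then
`lim_{N→∞} ∫_{‖ξ‖≤N} e^{i x·ξ}(‖ξ‖² + 2 p·ξ + 2i q·ξ)⁻¹ dξ` exists in `ℂ`
(the integrand being Lebesgue integrable on each disc `{‖ξ‖ ≤ N}`). -/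
theorem faddeev_green_function_exists
    (p q : EuclideanSpace ℝ (Fin 2)) (hq : q ≠ 0) (hpq : (inner ℝ p q : ℝ) = 0)
    (x : EuclideanSpace ℝ (Fin 2)) (hx : x ≠ 0) :
    (∀ N : ℝ,
      IntegrableOn
        (fun ξ : EuclideanSpace ℝ (Fin 2) =>
          Complex.exp (Complex.I * ((inner ℝ x ξ : ℝ) : ℂ)) *
            (((‖ξ‖ ^ 2 + 2 * (inner ℝ p ξ : ℝ) : ℝ) : ℂ)
              + 2 * Complex.I * ((inner ℝ q ξ : ℝ) : ℂ))⁻¹)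
        (Metric.closedBall 0 N)) ∧
    ∃ L : ℂ,
      Tendsto
        (fun N : ℝ =>
          ∫ ξ in Metric.closedBall (0 : EuclideanSpace ℝ (Fin 2)) N,
            Complex.exp (Complex.I * ((inner ℝ x ξ : ℝ) : ℂ)) *
              (((‖ξ‖ ^ 2 + 2 * (inner ℝ p ξ : ℝ) : ℝ) : ℂ)
                + 2 * Complex.I * ((inner ℝ q ξ : ℝ) : ℂ))⁻¹)
        atTop (𝓝 L) := by
  set P : EuclideanSpace ℝ (Fin 2) → ℂ := fun ξ => (((‖ξ‖ ^ 2 + 2 * (inner ℝ p ξ : ℝ) : ℝ) : ℂ)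
    + 2 * Complex.I * ((inner ℝ q ξ : ℝ) : ℂ))⁻¹ with hP
  set e : EuclideanSpace ℝ (Fin 2) → ℂ := fun ξ => Complex.exp (Complex.I * ((inner ℝ x ξ : ℝ) : ℂ))
    with he
  set h : EuclideanSpace ℝ (Fin 2) → ℂ := fun ξ => (((1 + ‖ξ‖ ^ 2)⁻¹ : ℝ) : ℂ) with hh
  have hen : ∀ ξ, ‖e ξ‖ ≤ 1 := fun ξ => by
    simp only [he]; rw [mul_comm]; exact (Complex.norm_exp_ofReal_mul_I _).le
  have hec : Continuous e := by simp only [he]; fun_prop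
  have hhc : Continuous h := by
    simp only [hh]
    refine Complex.continuous_ofReal.comp (Continuous.inv₀ (by fun_prop) fun ξ => by positivity)
  have hPi : ∀ N, IntegrableOn P (Metric.closedBall 0 N) := symbol_integrable p q hq hpq
  have hint : ∀ (f : EuclideanSpace ℝ (Fin 2) → ℂ), Continuous f → ∀ N,
      IntegrableOn f (Metric.closedBall 0 N) := fun f hf N =>
    hf.continuousOn.integrableOn_compact (isCompact_closedBall 0 N)
  have hePi : ∀ N, IntegrableOn (fun ξ => e ξ * P ξ) (Metric.closedBall 0 N) := fun N =>
    (hPi N).bdd_mul hec.aestronglyMeasurable (Eventually.of_forall hen)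
  refine ⟨hePi, ?_⟩
  have hPm : Measurable P := by simp only [hP]; fun_prop
  have hD : Integrable (fun ξ => P ξ - h ξ) := by
    rw [← integrableOn_univ, ← Set.union_compl_self (Metric.closedBall 0 (4 * ‖p‖ + 1))]
    refine IntegrableOn.union ((hPi _).sub (hint h hhc _)) ?_
    refine Integrable.mono' (jap_int.const_mul
      (16 * (1 + 2 * ‖p‖ + 2 * ‖q‖))).integrableOn ?_ ?_
    · exact (hPm.sub hhc.measurable).aestronglyMeasurable
    · rw [ae_restrict_iff' measurableSet_closedBall.compl]
      refine Eventually.of_forall fun ξ hξ => ?_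
      have : 4 * ‖p‖ + 1 < ‖ξ‖ := by simpa using hξ
      exact remainder_bound p q ξ this.le
  have heD : Integrable (fun ξ => e ξ * (P ξ - h ξ)) :=
    hD.bdd_mul hec.aestronglyMeasurable (Eventually.of_forall hen)
  obtain ⟨L, hL⟩ := base_limit x hx
  refine ⟨_, ((disc_tendsto _ heD).add hL).congr fun N => ?_⟩
  have hehc : Continuous (fun ξ => e ξ * h ξ) := hec.mul hhc
  rw [← integral_add heD.integrableOn (hint _ hehc N)]
  congr 1
  ext ξ
  simp only [hh]
  ring
end

section
/- Let k ∈ ℝ², k ≠ 0, and x ∈ ℝ², x ≠ 0. Then for each ε > 0 the function ξ ↦ e^{i x·ξ}·(‖ξ‖² + 2 k·ξ + 2iε k·ξ)⁻¹ is Lebesgue integrable on each disc {‖ξ‖ ≤ N}, for each N > 2|k| the limit A_N := lim_{ε→0⁺} ∫_{‖ξ‖≤N} e^{i x·ξ}·(‖ξ‖² + 2 k·ξ + 2iε k·ξ)⁻¹ dξ exists in ℂ, and the limit lim_{N→∞} A_N exists in ℂ. -/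
open MeasureTheory Real Filter Topology

namespace ScatGreen

noncomputable def zz (s ε : ℝ) : ℂ := ((2 * s : ℝ) : ℂ) + ((2 * ε * s : ℝ) : ℂ) * Complex.I

noncomputable def ee (t : ℝ) : ℂ := Complex.exp (Complex.I * (t : ℂ))

noncomputable def Kf (a s ε r : ℝ) : ℂ := ee (r * a) * ((r : ℂ) + zz s ε)⁻¹

noncomputable def J (a s ε N : ℝ) : ℂ := ∫ r in (0 : ℝ)..N, Kf a s ε r

lemma zz_re (s ε : ℝ) : (zz s ε).re = 2 * s := by simp [zz]
lemma zz_im (s ε : ℝ) : (zz s ε).im = 2 * ε * s := by simp [zz]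

lemma ee_norm (t : ℝ) : ‖ee t‖ = 1 := by
  unfold ee; rw [mul_comm]; exact Complex.norm_exp_ofReal_mul_I t

lemma ee_cont : Continuous ee := by unfold ee; fun_prop

lemma ee_lip (t u : ℝ) : ‖ee t - ee u‖ ≤ |t - u| := by
  have h : ee t - ee u = ee u * (Complex.exp (Complex.I * ((t - u : ℝ) : ℂ)) - 1) := by
    unfold ee
    rw [mul_sub, ← Complex.exp_add]
    push_cast
    ring_nf
  rw [h, norm_mul, ee_norm, one_mul]
  simpa using Real.norm_exp_I_mul_ofReal_sub_one_le (x := t - u)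

lemma zz_cont (s : ℝ) : Continuous (zz s) := by unfold zz; fun_prop

lemma den_norm_ge (s ε r : ℝ) : |r + 2 * s| ≤ ‖(r : ℂ) + zz s ε‖ := by
  have := Complex.abs_re_le_norm ((r : ℂ) + zz s ε)
  simpa [zz_re] using this

lemma den_norm_ge' (s ε r : ℝ) : |2 * ε * s| ≤ ‖(r : ℂ) + zz s ε‖ := by
  have := Complex.abs_im_le_norm ((r : ℂ) + zz s ε)
  simpa [zz_im] using this

lemma den_slit {s ε : ℝ} (hs : s ≠ 0) (he : 0 < ε) (r : ℝ) :
    (r : ℂ) + zz s ε ∈ Complex.slitPlane := by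
  rw [Complex.mem_slitPlane_iff]; right
  simp [zz_im, hs, he.ne']

lemma den_ne {s ε : ℝ} (hs : s ≠ 0) (he : 0 < ε) (r : ℝ) : (r : ℂ) + zz s ε ≠ 0 :=
  Complex.slitPlane_ne_zero (den_slit hs he r)

lemma inv_cont {s ε : ℝ} (hs : s ≠ 0) (he : 0 < ε) :
    Continuous (fun r : ℝ => ((r : ℂ) + zz s ε)⁻¹) :=
  Continuous.inv₀ (by fun_prop) (den_ne hs he)

lemma Kf_cont {a s ε : ℝ} (hs : s ≠ 0) (he : 0 < ε) : Continuous (Kf a s ε) := by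
  unfold Kf
  exact (ee_cont.comp (by fun_prop)).mul (inv_cont hs he)

lemma int_inv {s ε : ℝ} (hs : s ≠ 0) (he : 0 < ε) (N : ℝ) :
    ∫ r in (0 : ℝ)..N, ((r : ℂ) + zz s ε)⁻¹ =
      Complex.log ((N : ℂ) + zz s ε) - Complex.log (zz s ε) := by
  have h := intervalIntegral.integral_eq_sub_of_hasDerivAt (a := 0) (b := N)
    (f := fun r : ℝ => Complex.log ((r : ℂ) + zz s ε))
    (f' := fun r : ℝ => ((r : ℂ) + zz s ε)⁻¹) ?_ ?_
  · rw [h]; simp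
  · intro r _
    have h1 : HasDerivAt (fun r : ℝ => (r : ℂ) + zz s ε) 1 r :=
      (Complex.ofRealCLM.hasDerivAt (x := r)).add_const _
    have := h1.clog_real (den_slit hs he r)
    simpa using this
  · exact (inv_cont hs he).intervalIntegrable _ _

lemma J_split {a s ε : ℝ} (hs : s ≠ 0) (he : 0 < ε) (N : ℝ) :
    J a s ε N = (∫ r in (0 : ℝ)..N, (ee (r * a) - ee (-(2 * s) * a)) * ((r : ℂ) + zz s ε)⁻¹) +
      ee (-(2 * s) * a) * (Complex.log ((N : ℂ) + zz s ε) - Complex.log (zz s ε)) := by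
  rw [← int_inv hs he, ← intervalIntegral.integral_const_mul, ← intervalIntegral.integral_add]
  · unfold J
    congr 1; ext r; unfold Kf; ring
  · exact (((ee_cont.comp (by fun_prop)).sub continuous_const).mul
      (inv_cont hs he)).intervalIntegrable _ _
  · exact (continuous_const.mul (inv_cont hs he)).intervalIntegrable _ _

lemma quot_bound (a s ε r : ℝ) :
    ‖(ee (r * a) - ee (-(2 * s) * a)) * ((r : ℂ) + zz s ε)⁻¹‖ ≤ |a| := by
  rw [norm_mul, norm_inv]
  have h1 := ee_lip (r * a) (-(2 * s) * a)
  have h2 := den_norm_ge s ε r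
  have h3 : |r * a - -(2 * s) * a| = |a| * |r + 2 * s| := by
    rw [← abs_mul]; ring_nf
  rw [h3] at h1
  rcases eq_or_ne ‖(r : ℂ) + zz s ε‖ 0 with h0 | h0
  · rw [h0]; simp
  · have hp : 0 < ‖(r : ℂ) + zz s ε‖ := lt_of_le_of_ne (norm_nonneg _) h0.symm
    rw [← div_eq_mul_inv, div_le_iff₀ hp]
    exact h1.trans (mul_le_mul_of_nonneg_left h2 (abs_nonneg a))

lemma quot_tendsto (a s N : ℝ) (hs : s ≠ 0) :
    ∃ l, Tendsto (fun ε => ∫ r in (0 : ℝ)..N,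
      (ee (r * a) - ee (-(2 * s) * a)) * ((r : ℂ) + zz s ε)⁻¹) (𝓝[>] 0) (𝓝 l) := by
  refine ⟨∫ r in (0 : ℝ)..N, (ee (r * a) - ee (-(2 * s) * a)) * ((r : ℂ) + zz s 0)⁻¹, ?_⟩
  apply intervalIntegral.tendsto_integral_filter_of_dominated_convergence (fun _ => |a|)
  · filter_upwards [self_mem_nhdsWithin] with ε he
    exact (((ee_cont.comp (by fun_prop)).sub continuous_const).mul
      (inv_cont hs he)).aestronglyMeasurable
  · exact Eventually.of_forall fun ε => Eventually.of_forall fun r _ => quot_bound a s ε r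
  · exact intervalIntegrable_const
  · have : ∀ᵐ r : ℝ, r ≠ -(2 * s) := by
      simp [ae_iff]
    filter_upwards [this] with r hr _
    refine Tendsto.mul tendsto_const_nhds ?_
    refine Tendsto.inv₀ ?_ ?_
    · exact ((continuous_const.add (zz_cont s)).tendsto 0).mono_left nhdsWithin_le_nhds
    · intro h
      have := congrArg Complex.re h
      simp [zz_re] at this
      apply hr; linarith

lemma logz_tendsto {s : ℝ} (hs : s ≠ 0) :
    ∃ l, Tendsto (fun ε => Complex.log (zz s ε)) (𝓝[>] 0) (𝓝 l) := by
  have h0 : Tendsto (zz s) (𝓝[>] 0) (𝓝 (zz s 0)) :=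
    ((zz_cont s).tendsto 0).mono_left nhdsWithin_le_nhds
  rcases lt_or_gt_of_ne hs with h | h
  · refine ⟨_, (Complex.tendsto_log_nhdsWithin_im_neg_of_re_neg_of_im_zero (z := zz s 0)
      (by rw [zz_re]; linarith) (by rw [zz_im]; simp)).comp
      (tendsto_nhdsWithin_iff.mpr ⟨h0, ?_⟩)⟩
    filter_upwards [self_mem_nhdsWithin] with ε he
    have he' : 0 < ε := he
    simp only [zz_im]
    nlinarith
  · exact ⟨_, h0.clog (by rw [Complex.mem_slitPlane_iff]; left; rw [zz_re]; linarith)⟩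

lemma logN_tendsto {s N : ℝ} (hN : 2 * |s| < N) :
    ∃ l, Tendsto (fun ε => Complex.log ((N : ℂ) + zz s ε)) (𝓝[>] 0) (𝓝 l) := by
  have h0 : Tendsto (fun ε => (N : ℂ) + zz s ε) (𝓝[>] 0) (𝓝 ((N : ℂ) + zz s 0)) :=
    ((continuous_const.add (zz_cont s)).tendsto 0).mono_left nhdsWithin_le_nhds
  refine ⟨_, h0.clog ?_⟩
  rw [Complex.mem_slitPlane_iff]; left
  simp only [Complex.add_re, Complex.ofReal_re, zz_re]
  have := neg_abs_le s
  linarith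

lemma J_tendsto {a s N : ℝ} (hs : s ≠ 0) (hN : 2 * |s| < N) :
    ∃ l, Tendsto (fun ε => J a s ε N) (𝓝[>] 0) (𝓝 l) := by
  obtain ⟨l1, h1⟩ := quot_tendsto a s N hs
  obtain ⟨l2, h2⟩ := logz_tendsto hs
  obtain ⟨l3, h3⟩ := logN_tendsto hN
  refine ⟨l1 + ee (-(2 * s) * a) * (l3 - l2), Tendsto.congr' ?_
    (h1.add ((h3.sub h2).const_mul (ee (-(2 * s) * a))))⟩
  filter_upwards [self_mem_nhdsWithin] with ε he
  exact (J_split hs he N).symm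

lemma clog_bound (z : ℂ) : ‖Complex.log z‖ ≤ |Real.log ‖z‖| + π := by
  refine (Complex.norm_le_abs_re_add_abs_im _).trans ?_
  rw [Complex.log_re, Complex.log_im]
  gcongr
  exact Complex.abs_arg_le_pi z

lemma abs_log_le_of_mem {l u t : ℝ} (hl : 0 < l) (h1 : l ≤ t) (h2 : t ≤ u) :
    |Real.log t| ≤ |Real.log l| + |Real.log u| := by
  have a1 := Real.log_le_log hl h1
  have a2 := Real.log_le_log (hl.trans_le h1) h2
  rw [abs_le]
  have := neg_abs_le (Real.log l)
  have := le_abs_self (Real.log u)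
  have := abs_nonneg (Real.log u)
  have := abs_nonneg (Real.log l)
  constructor <;> linarith

lemma zz_norm_le {s ε : ℝ} (he : 0 < ε) (he1 : ε ≤ 1) : ‖zz s ε‖ ≤ 4 * |s| := by
  refine (Complex.norm_le_abs_re_add_abs_im _).trans ?_
  rw [zz_re, zz_im, abs_mul, abs_mul, abs_mul, abs_of_pos he]
  have := abs_nonneg s
  norm_num
  nlinarith

/-- the bound for `J`. -/
noncomputable def Cb (K X N : ℝ) : ℝ :=
  |N| * X + (|Real.log (N - 2 * K)| + |Real.log (N + 4 * K)| + π) +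
    (|Real.log 2| + |Real.log 4| + π)

lemma J_bound {a s ε N K X : ℝ} (hs : s ≠ 0) (he : 0 < ε) (he1 : ε ≤ 1) (hN : 2 * K < N)
    (hK : |s| ≤ K) (hX : |a| ≤ X) :
    ‖J a s ε N‖ ≤ Cb K X N + 2 * |Real.log (|s|)| := by
  have hsp : 0 < |s| := abs_pos.mpr hs
  rw [J_split hs he]
  refine (norm_add_le _ _).trans ?_
  rw [norm_mul, ee_norm, one_mul]
  have b1 : ‖∫ r in (0 : ℝ)..N, (ee (r * a) - ee (-(2 * s) * a)) * ((r : ℂ) + zz s ε)⁻¹‖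
      ≤ |a| * |N - 0| :=
    intervalIntegral.norm_integral_le_of_norm_le_const fun r _ => quot_bound a s ε r
  rw [sub_zero] at b1
  have b1' : |a| * |N| ≤ |N| * X := by
    rw [mul_comm]; exact mul_le_mul_of_nonneg_left hX (abs_nonneg _)
  have b2 := norm_sub_le (Complex.log ((N : ℂ) + zz s ε)) (Complex.log (zz s ε))
  have b3 : ‖Complex.log ((N : ℂ) + zz s ε)‖ ≤
      |Real.log (N - 2 * K)| + |Real.log (N + 4 * K)| + π := by
    refine (clog_bound _).trans ?_
    gcongr
    apply abs_log_le_of_mem (by linarith)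
    · refine le_trans ?_ (den_norm_ge s ε N)
      have := le_abs_self (N + 2 * s)
      have := neg_abs_le s
      linarith
    · refine (norm_add_le _ _).trans ?_
      have := zz_norm_le (s := s) he he1
      have h : ‖(N : ℂ)‖ = N := by
        rw [Complex.norm_real, Real.norm_eq_abs, abs_of_pos]
        linarith
      linarith
  have b4 : ‖Complex.log (zz s ε)‖ ≤ |Real.log 2| + |Real.log 4| + π + 2 * |Real.log (|s|)| := by
    have h1 := clog_bound (zz s ε)
    have h2 : |Real.log ‖zz s ε‖| ≤ |Real.log (2 * |s|)| + |Real.log (4 * |s|)| := by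
      apply abs_log_le_of_mem (by linarith)
      · have := den_norm_ge s ε 0
        simpa [abs_mul] using this
      · exact zz_norm_le he he1
    rw [Real.log_mul (by norm_num) hsp.ne', Real.log_mul (by norm_num) hsp.ne'] at h2
    have h3 := abs_add_le (Real.log 2) (Real.log |s|)
    have h4 := abs_add_le (Real.log 4) (Real.log |s|)
    linarith
  unfold Cb
  linarith

noncomputable def J0 (a s N : ℝ) : ℂ := limUnder (𝓝[>] 0) (fun ε => J a s ε N)

lemma J0_tendsto {a s N : ℝ} (hs : s ≠ 0) (hN : 2 * |s| < N) :
    Tendsto (fun ε => J a s ε N) (𝓝[>] 0) (𝓝 (J0 a s N)) :=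
  tendsto_nhds_limUnder (J_tendsto hs hN)

lemma J0_bound {a s N K X : ℝ} (hs : s ≠ 0) (hN : 2 * K < N)
    (hK : |s| ≤ K) (hX : |a| ≤ X) :
    ‖J0 a s N‖ ≤ Cb K X N + 2 * |Real.log (|s|)| := by
  refine le_of_tendsto (J0_tendsto (a := a) hs (by linarith : 2 * |s| < N)).norm ?_
  have : Set.Ioc (0 : ℝ) 1 ∈ 𝓝[>] (0 : ℝ) := Ioc_mem_nhdsGT one_pos
  filter_upwards [this] with ε he
  exact J_bound hs he.1 he.2 hN hK hX

lemma J0_diff {a s M N : ℝ} (hs : s ≠ 0) (hM : 2 * |s| < M) (hMN : M ≤ N) :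
    J0 a s N - J0 a s M = ∫ r in M..N, ee (r * a) * ((r + 2 * s : ℝ) : ℂ)⁻¹ := by
  have h1 := (J0_tendsto (a := a) hs (hM.trans_le hMN)).sub (J0_tendsto (a := a) hs hM)
  refine tendsto_nhds_unique h1 ?_
  have h2 : Tendsto (fun ε => ∫ r in M..N, Kf a s ε r) (𝓝[>] 0)
      (𝓝 (∫ r in M..N, ee (r * a) * ((r + 2 * s : ℝ) : ℂ)⁻¹)) := by
    have hpos : ∀ r ∈ Set.uIoc M N, M - 2 * |s| ≤ r + 2 * s := by
      intro r hr
      rw [Set.uIoc_of_le hMN] at hr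
      have := neg_abs_le s
      linarith [hr.1]
    apply intervalIntegral.tendsto_integral_filter_of_dominated_convergence
      (fun _ => (M - 2 * |s|)⁻¹)
    · filter_upwards [self_mem_nhdsWithin] with ε he
      exact (Kf_cont hs he).aestronglyMeasurable
    · refine Eventually.of_forall fun ε => Eventually.of_forall fun r hr => ?_
      unfold Kf
      rw [norm_mul, ee_norm, one_mul, norm_inv]
      apply inv_anti₀ (by linarith)
      exact (hpos r hr).trans ((le_abs_self _).trans (den_norm_ge s ε r))
    · exact intervalIntegrable_const
    · refine Eventually.of_forall fun r hr => ?_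
      unfold Kf
      refine Tendsto.mul tendsto_const_nhds ?_
      have h3 : ((r + 2 * s : ℝ) : ℂ) = (r : ℂ) + zz s 0 := by simp [zz]
      refine Tendsto.inv₀ ?_ ?_
      · rw [h3]
        exact ((continuous_const.add (zz_cont s)).tendsto 0).mono_left nhdsWithin_le_nhds
      · have := hpos r hr
        rw [Complex.ofReal_ne_zero]
        linarith
  refine h2.congr' ?_
  filter_upwards [self_mem_nhdsWithin] with ε he
  unfold J
  rw [intervalIntegral.integral_interval_sub_left] <;>
    exact (Kf_cont hs he).intervalIntegrable _ _

lemma osc_bound {a s T N : ℝ} (ha : a ≠ 0) (hT : 0 < T) (hs : 4 * |s| ≤ T) (hTN : T ≤ N) :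
    ‖∫ r in T..N, ee (r * a) * ((r + 2 * s : ℝ) : ℂ)⁻¹‖ ≤ 4 / (|a| * T) := by
  have hsl := neg_abs_le s
  have hpos : ∀ r ∈ Set.uIcc T N, T / 2 ≤ r + 2 * s := by
    intro r hr
    rw [Set.uIcc_of_le hTN] at hr
    linarith [hr.1]
  have hne : ∀ r ∈ Set.uIcc T N, r + 2 * s ≠ 0 := fun r hr => by linarith [hpos r hr]
  have haC : (Complex.I * (a : ℂ)) ≠ 0 := mul_ne_zero Complex.I_ne_zero (by exact_mod_cast ha)
  have hcont : ContinuousOn (fun r : ℝ => ((r + 2 * s) ^ 2)⁻¹) (Set.uIcc T N) :=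
    ContinuousOn.inv₀ (by fun_prop) (fun r hr => pow_ne_zero _ (hne r hr))
  have hd : ∀ r ∈ Set.uIcc T N, HasDerivAt (fun r : ℝ => (r + 2 * s)⁻¹)
      (-((r + 2 * s) ^ 2)⁻¹) r := by
    intro r hr
    have h1 : HasDerivAt (fun r : ℝ => r + 2 * s) 1 r := (hasDerivAt_id r).add_const _
    have h2 := h1.fun_inv (hne r hr)
    have h3 : -((r + 2 * s) ^ 2)⁻¹ = -1 / (r + 2 * s) ^ 2 := by rw [neg_div, one_div]
    rw [h3]
    exact h2
  have ibp := intervalIntegral.integral_mul_deriv_eq_deriv_mul (a := T) (b := N)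
    (u := fun r : ℝ => (((r + 2 * s)⁻¹ : ℝ) : ℂ))
    (u' := fun r : ℝ => ((-((r + 2 * s) ^ 2)⁻¹ : ℝ) : ℂ))
    (v := fun r : ℝ => ee (r * a) / (Complex.I * a))
    (v' := fun r : ℝ => ee (r * a))
    (fun r hr => (hd r hr).ofReal_comp) ?_ ?_ ?_
  · have h0 : (∫ r in T..N, ee (r * a) * ((r + 2 * s : ℝ) : ℂ)⁻¹) =
        ∫ r in T..N, (((r + 2 * s)⁻¹ : ℝ) : ℂ) * ee (r * a) := by
      congr 1; ext r; rw [mul_comm, Complex.ofReal_inv]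
    have hv : ∀ r : ℝ, ‖ee (r * a) / (Complex.I * a)‖ = |a|⁻¹ := by
      intro r; simp [ee_norm]
    have hTp : T / 2 ≤ T + 2 * s := hpos T (by simp)
    have hNp : T / 2 ≤ N + 2 * s := hpos N (by simp)
    have hint : ∫ r in T..N, ((r + 2 * s) ^ 2)⁻¹ = (T + 2 * s)⁻¹ - (N + 2 * s)⁻¹ := by
      have := intervalIntegral.integral_eq_sub_of_hasDerivAt (a := T) (b := N) (fun r hr => hd r hr)
        (hcont.neg.intervalIntegrable)
      rw [intervalIntegral.integral_neg] at this
      linarith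
    have hb : ‖∫ r in T..N, ((-((r + 2 * s) ^ 2)⁻¹ : ℝ) : ℂ) * (ee (r * a) / (Complex.I * a))‖ ≤
        |a|⁻¹ * ((T + 2 * s)⁻¹ - (N + 2 * s)⁻¹) := by
      rw [← hint, ← intervalIntegral.integral_const_mul]
      apply intervalIntegral.norm_integral_le_of_norm_le hTN
      · refine Eventually.of_forall fun r _ => ?_
        rw [norm_mul, hv, Complex.norm_real, norm_neg, Real.norm_eq_abs, abs_of_nonneg (by positivity),
          mul_comm]
      · exact (continuousOn_const.mul hcont).intervalIntegrable
    have n1 : ‖(((N + 2 * s)⁻¹ : ℝ) : ℂ) * (ee (N * a) / (Complex.I * a))‖ =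
        |a|⁻¹ * (N + 2 * s)⁻¹ := by
      rw [norm_mul, hv, Complex.norm_real, Real.norm_eq_abs,
        abs_of_nonneg (inv_nonneg.mpr (by linarith)), mul_comm]
    have n2 : ‖(((T + 2 * s)⁻¹ : ℝ) : ℂ) * (ee (T * a) / (Complex.I * a))‖ =
        |a|⁻¹ * (T + 2 * s)⁻¹ := by
      rw [norm_mul, hv, Complex.norm_real, Real.norm_eq_abs,
        abs_of_nonneg (inv_nonneg.mpr (by linarith)), mul_comm]
    rw [h0, ibp]
    refine (norm_sub_le _ _).trans ?_
    refine (add_le_add (norm_sub_le _ _) hb).trans ?_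
    rw [n1, n2]
    have hap : 0 < |a| := abs_pos.mpr ha
    have : (T + 2 * s)⁻¹ ≤ (T / 2)⁻¹ := inv_anti₀ (by linarith) hTp
    calc _ = 2 * |a|⁻¹ * (T + 2 * s)⁻¹ := by ring
      _ ≤ 2 * |a|⁻¹ * (T / 2)⁻¹ := by gcongr
      _ = 4 / (|a| * T) := by field_simp; norm_num
  · intro r _
    have h1 : HasDerivAt (fun r : ℝ => Complex.I * ((r * a : ℝ) : ℂ)) (Complex.I * a) r := by
      have := ((hasDerivAt_id r).mul_const a).ofReal_comp.const_mul Complex.I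
      simpa using this
    have h2 := h1.cexp.div_const (Complex.I * a)
    unfold ee
    convert h2 using 1
    rw [mul_div_cancel_right₀ _ haC]
  · exact (Complex.continuous_ofReal.comp_continuousOn hcont.neg).intervalIntegrable
  · exact (ee_cont.comp (by fun_prop)).intervalIntegrable _ _

lemma triv_bound {a s T N : ℝ} (hT : 0 < T) (hs : 4 * |s| ≤ T) (hTN : T ≤ N) :
    ‖∫ r in T..N, ee (r * a) * ((r + 2 * s : ℝ) : ℂ)⁻¹‖ ≤ 2 * Real.log (N / T) := by
  have hsl := neg_abs_le s
  rw [← integral_inv_of_pos hT (hT.trans_le hTN), ← intervalIntegral.integral_const_mul]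
  apply intervalIntegral.norm_integral_le_of_norm_le hTN
  · refine Eventually.of_forall fun r hr => ?_
    have hr1 := hr.1
    rw [norm_mul, ee_norm, one_mul, norm_inv, Complex.norm_real, Real.norm_eq_abs]
    have : r / 2 ≤ |r + 2 * s| := le_trans (by linarith) (le_abs_self _)
    refine (inv_anti₀ (by linarith) this).trans (le_of_eq ?_)
    rw [inv_div]; ring
  · refine (ContinuousOn.mul continuousOn_const (ContinuousOn.inv₀ continuousOn_id ?_)).intervalIntegrable
    intro r hr
    rw [Set.uIcc_of_le hTN] at hr
    exact (hT.trans_le hr.1).ne'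

lemma unif_bound {a s T N : ℝ} (ha : a ≠ 0) (hT : 1 ≤ T) (hs : 4 * |s| ≤ T) (hTN : T ≤ N) :
    ‖∫ r in T..N, ee (r * a) * ((r + 2 * s : ℝ) : ℂ)⁻¹‖ ≤ 4 + 2 * |Real.log (|a|)| := by
  have hap : 0 < |a| := abs_pos.mpr ha
  have hT0 : 0 < T := by linarith
  have key : ∀ R, T ≤ R → R ≤ |a|⁻¹ → 2 * Real.log (R / T) ≤ 2 * |Real.log (|a|)| := by
    intro R h1 h2
    have : Real.log (R / T) ≤ Real.log |a|⁻¹ := by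
      apply Real.log_le_log (div_pos (by linarith) hT0)
      exact (div_le_self (by linarith) hT).trans h2
    rw [Real.log_inv] at this
    have := neg_le_abs (Real.log |a|)
    linarith
  rcases le_or_gt |a|⁻¹ T with h | h
  · refine (osc_bound ha hT0 hs hTN).trans ?_
    have h1 : 1 ≤ |a| * T := by
      have := mul_le_mul_of_nonneg_left h hap.le
      rwa [mul_inv_cancel₀ hap.ne'] at this
    have : 4 / (|a| * T) ≤ 4 := div_le_self (by norm_num) h1
    have := abs_nonneg (Real.log |a|)
    linarith
  · rcases le_or_gt N |a|⁻¹ with h' | h'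
    · have := triv_bound (a := a) hT0 hs hTN
      linarith [key N hTN h']
    · have hc : ∀ u v : ℝ, T ≤ u → T ≤ v →
          IntervalIntegrable (fun r => ee (r * a) * ((r + 2 * s : ℝ) : ℂ)⁻¹) volume u v := by
        intro u v hu hv
        apply ContinuousOn.intervalIntegrable
        refine ContinuousOn.mul (ee_cont.comp (by fun_prop)).continuousOn
          (ContinuousOn.inv₀ (by fun_prop) ?_)
        intro r hr
        have : T ≤ r := (le_min hu hv).trans hr.1
        have := neg_abs_le s
        rw [Complex.ofReal_ne_zero]
        linarith
      rw [← intervalIntegral.integral_add_adjacent_intervals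
        (hc T |a|⁻¹ le_rfl h.le) (hc |a|⁻¹ N h.le hTN)]
      refine (norm_add_le _ _).trans ?_
      have t1 := triv_bound (a := a) hT0 hs h.le
      have t2 := osc_bound (s := s) ha (inv_pos.mpr hap) (hs.trans h.le) h'.le
      rw [mul_inv_cancel₀ hap.ne'] at t2
      linarith [key _ h.le le_rfl]

lemma J0_lim {a s T : ℝ} (hs : s ≠ 0) (ha : a ≠ 0) (hT : 1 ≤ T) (hsT : 4 * |s| ≤ T) :
    ∃ l, Tendsto (fun N => J0 a s N) atTop (𝓝 l) := by
  apply cauchySeq_tendsto_of_complete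
  have hap : 0 < |a| := abs_pos.mpr ha
  have hsp : 0 < |s| := abs_pos.mpr hs
  rw [Metric.cauchySeq_iff']
  intro δ hδ
  refine ⟨max T (8 / (|a| * δ)), fun n hn => ?_⟩
  set M := max T (8 / (|a| * δ))
  have hTM : T ≤ M := le_max_left _ _
  have hM0 : 0 < M := by linarith
  rw [dist_eq_norm, J0_diff hs (by linarith) hn]
  refine (osc_bound ha hM0 (by linarith) hn).trans_lt ?_
  have : 8 / (|a| * δ) ≤ M := le_max_right _ _
  rw [div_le_iff₀ (by positivity)] at this
  rw [div_lt_iff₀ (by positivity)]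
  nlinarith

lemma J0_unif {a s T N K X : ℝ} (hs : s ≠ 0) (ha : a ≠ 0) (hT : 1 ≤ T) (hKT : 4 * K ≤ T)
    (hTN : T ≤ N) (hK : |s| ≤ K) (hX : |a| ≤ X) :
    ‖J0 a s N‖ ≤ (Cb K X T + 4) + 2 * |Real.log (|s|)| + 2 * |Real.log (|a|)| := by
  have hsp : 0 < |s| := abs_pos.mpr hs
  have h1 := J0_diff (a := a) hs (by linarith : 2 * |s| < T) hTN
  have h2 : J0 a s N = J0 a s T + ∫ r in T..N, ee (r * a) * ((r + 2 * s : ℝ) : ℂ)⁻¹ := by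
    rw [← h1]; ring
  rw [h2]
  refine (norm_add_le _ _).trans ?_
  have := J0_bound (a := a) hs (by linarith : 2 * K < T) hK hX
  have := unif_bound ha hT (by linarith : 4 * |s| ≤ T) hTN
  linarith

/-- angular factor: inner product with the unit vector of angle `θ`. -/
noncomputable def cc (v : EuclideanSpace ℝ (Fin 2)) (θ : ℝ) : ℝ := v 0 * cos θ + v 1 * sin θ

lemma cc_cont (v : EuclideanSpace ℝ (Fin 2)) : Continuous (cc v) := by unfold cc; fun_prop

noncomputable def eqv : ℝ × ℝ ≃ᵐ EuclideanSpace ℝ (Fin 2) :=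
  (MeasurableEquiv.finTwoArrow (α := ℝ)).symm.trans (MeasurableEquiv.toLp 2 (Fin 2 → ℝ))

lemma eqv_pres : MeasurePreserving eqv volume volume :=
  (PiLp.volume_preserving_toLp (Fin 2)).comp (volume_preserving_finTwoArrow ℝ).symm

noncomputable def pol (p : ℝ × ℝ) : EuclideanSpace ℝ (Fin 2) := eqv (polarCoord.symm p)

lemma pol_eq (p : ℝ × ℝ) : pol p = !₂[p.1 * cos p.2, p.1 * sin p.2] := by
  ext i
  fin_cases i <;> simp [pol, eqv, polarCoord]

lemma inner_pol (v : EuclideanSpace ℝ (Fin 2)) (p : ℝ × ℝ) :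
    (inner ℝ v (pol p) : ℝ) = p.1 * cc v p.2 := by
  rw [pol_eq]
  simp [PiLp.inner_apply, Fin.sum_univ_two, cc]
  ring

lemma norm_pol_sq (p : ℝ × ℝ) : ‖pol p‖ ^ 2 = p.1 ^ 2 := by
  rw [pol_eq, EuclideanSpace.norm_sq_eq]
  simp [Fin.sum_univ_two]
  have := cos_sq_add_sin_sq p.2
  linear_combination p.1 ^ 2 * this

lemma norm_pol (p : ℝ × ℝ) (hp : 0 ≤ p.1) : ‖pol p‖ = p.1 := by
  have := norm_pol_sq p
  rwa [sq_eq_sq₀ (norm_nonneg _) hp] at this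

lemma cc_le (v : EuclideanSpace ℝ (Fin 2)) (θ : ℝ) : |cc v θ| ≤ ‖v‖ := by
  have h := abs_real_inner_le_norm v (pol (1, θ))
  rw [inner_pol, norm_pol _ (by simp)] at h
  simpa using h

lemma cc_analytic (v : EuclideanSpace ℝ (Fin 2)) : AnalyticOnNhd ℝ (cc v) Set.univ := by
  intro θ _
  unfold cc
  exact (analyticAt_const.mul Real.analyticAt_cos).add (analyticAt_const.mul Real.analyticAt_sin)

lemma cc_ae_ne {v : EuclideanSpace ℝ (Fin 2)} (hv : v ≠ 0) : ∀ᵐ θ : ℝ, cc v θ ≠ 0 := by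
  have h : cc v ⁻¹' {0}ᶜ ∈ codiscrete ℝ := by
    apply (cc_analytic v).preimage_zero_mem_codiscrete (x := if v 0 = 0 then π / 2 else 0)
    · split_ifs with h0
      · simp only [cc, h0]
        simp
        intro h1
        apply hv
        ext i
        fin_cases i <;> simp [h0, h1]
      · simpa [cc] using h0
  have h2 := ae_restrict_le_codiscreteWithin (μ := (volume : Measure ℝ)) MeasurableSet.univ h
  rw [Measure.restrict_univ] at h2
  exact h2

lemma cc_log_int (v : EuclideanSpace ℝ (Fin 2)) :
    Integrable (fun θ => |Real.log (|cc v θ|)|) (volume.restrict (Set.Ioo (-π) π)) := by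
  have h : MeromorphicOn (cc v) (Set.uIcc (-π) π) :=
    fun θ _ => (cc_analytic v θ (Set.mem_univ _)).meromorphicAt
  have := h.intervalIntegrable_log_norm.norm
  rw [intervalIntegrable_iff_integrableOn_Ioo_of_le (by linarith [pi_pos])] at this
  exact this

/-- the integrand. -/
noncomputable def gg (k x : EuclideanSpace ℝ (Fin 2)) (ε : ℝ) (ξ : EuclideanSpace ℝ (Fin 2)) : ℂ :=
  Complex.exp (Complex.I * ((inner ℝ x ξ : ℝ) : ℂ)) *
            (((‖ξ‖ ^ 2 + 2 * (inner ℝ k ξ : ℝ) : ℝ) : ℂ)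
              + 2 * Complex.I * (ε : ℂ) * ((inner ℝ k ξ : ℝ) : ℂ))⁻¹

lemma gg_pol (k x : EuclideanSpace ℝ (Fin 2)) (ε : ℝ) (p : ℝ × ℝ) (hp : 0 < p.1) :
    p.1 • gg k x ε (pol p) = Kf (cc x p.2) (cc k p.2) ε p.1 := by
  unfold gg Kf ee
  rw [inner_pol, inner_pol, norm_pol_sq]
  have h : (((p.1 ^ 2 + 2 * (p.1 * cc k p.2) : ℝ) : ℂ)
      + 2 * Complex.I * (ε : ℂ) * ((p.1 * cc k p.2 : ℝ) : ℂ)) =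
      (p.1 : ℂ) * ((p.1 : ℂ) + zz (cc k p.2) ε) := by
    unfold zz; push_cast; ring
  rw [h, mul_inv, Complex.real_smul]
  have : (p.1 : ℂ) ≠ 0 := by exact_mod_cast hp.ne'
  field_simp

noncomputable def KK (k x : EuclideanSpace ℝ (Fin 2)) (ε : ℝ) (p : ℝ × ℝ) : ℂ :=
  Kf (cc x p.2) (cc k p.2) ε p.1

lemma KK_meas (k x : EuclideanSpace ℝ (Fin 2)) (ε : ℝ) : Measurable (KK k x ε) := by
  unfold KK Kf zz ee
  have h1 := (cc_cont k).measurable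
  have h2 := (cc_cont x).measurable
  fun_prop

noncomputable def νr (N : ℝ) : Measure ℝ := volume.restrict (Set.Ioc 0 N)
noncomputable def νt : Measure ℝ := volume.restrict (Set.Ioo (-π) π)

instance (N : ℝ) : IsFiniteMeasure (νr N) := by unfold νr; infer_instance
instance : IsFiniteMeasure νt := by unfold νt; infer_instance

lemma prod_eq (N : ℝ) : (νr N).prod νt =
    (volume.restrict polarCoord.target).restrict {p : ℝ × ℝ | p.1 ≤ N} := by
  unfold νr νt
  rw [Measure.prod_restrict, ← Measure.volume_eq_prod, Measure.restrict_restrict]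
  · congr 1
    ext p
    simp only [polarCoord, Set.mem_prod, Set.mem_inter_iff, Set.mem_Ioc]
    constructor
    · rintro ⟨⟨h1, h2⟩, h3⟩; exact ⟨h2, h1, h3⟩
    · rintro ⟨h2, h1, h3⟩; exact ⟨⟨h1, h2⟩, h3⟩
  · exact measurableSet_le measurable_fst measurable_const

lemma transfer_fun (k x : EuclideanSpace ℝ (Fin 2)) (ε N : ℝ) (p : ℝ × ℝ)
    (hp : p ∈ polarCoord.target) :
    p.1 • (Metric.closedBall 0 N).indicator (gg k x ε) (pol p) =
      {p : ℝ × ℝ | p.1 ≤ N}.indicator (KK k x ε) p := by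
  have hp1 : 0 < p.1 := hp.1
  by_cases h : p.1 ≤ N
  · rw [Set.indicator_of_mem, Set.indicator_of_mem, gg_pol k x ε p hp1]
    · rfl
    · exact h
    · simpa [norm_pol p hp1.le] using h
  · rw [Set.indicator_of_notMem, Set.indicator_of_notMem, smul_zero]
    · exact h
    · simpa [norm_pol p hp1.le] using h

lemma mset (N : ℝ) : MeasurableSet {p : ℝ × ℝ | p.1 ≤ N} :=
  measurableSet_le measurable_fst measurable_const

lemma integral_transfer (k x : EuclideanSpace ℝ (Fin 2)) (ε N : ℝ) :
    ∫ ξ in Metric.closedBall 0 N, gg k x ε ξ = ∫ p, KK k x ε p ∂((νr N).prod νt) := by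
  rw [← integral_indicator Metric.isClosed_closedBall.measurableSet,
    ← eqv_pres.integral_comp eqv.measurableEmbedding, ← integral_comp_polarCoord_symm, prod_eq,
    ← integral_indicator (mset N)]
  apply setIntegral_congr_fun polarCoord.open_target.measurableSet
  intro p hp
  exact transfer_fun k x ε N p hp

lemma integrable_transfer (k x : EuclideanSpace ℝ (Fin 2)) (ε N : ℝ)
    (h : Integrable (KK k x ε) ((νr N).prod νt)) :
    IntegrableOn (gg k x ε) (Metric.closedBall 0 N) := by
  rw [← integrable_indicator_iff Metric.isClosed_closedBall.measurableSet,
    ← eqv_pres.integrable_comp_emb eqv.measurableEmbedding, ← integrableOn_univ]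
  rw [integrableOn_congr_set_ae polarCoord_source_ae_eq_univ.symm,
    ← polarCoord.symm_image_target_eq_source,
    integrableOn_image_iff_integrableOn_abs_det_fderiv_smul volume
      polarCoord.open_target.measurableSet
      (fun p _ => (hasFDerivAt_polarCoord_symm p).hasFDerivWithinAt) polarCoord.symm.injOn]
  rw [prod_eq] at h
  have h' : IntegrableOn (KK k x ε) {p : ℝ × ℝ | p.1 ≤ N} (volume.restrict polarCoord.target) := h
  rw [← integrable_indicator_iff (mset N)] at h'
  refine IntegrableOn.congr_fun h' ?_ polarCoord.open_target.measurableSet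
  intro p hp
  have hp1 : 0 < p.1 := hp.1
  simp only [det_fderivPolarCoordSymm, abs_of_pos hp1]
  exact (transfer_fun k x ε N p hp).symm

lemma Kf_le {a s ε r : ℝ} (he : 0 < ε) (hr : 0 < r) :
    ‖Kf a s ε r‖ ≤ (1 + 2 / ε) * (r + |s|)⁻¹ := by
  unfold Kf
  rw [norm_mul, ee_norm, one_mul, norm_inv]
  have h1 := den_norm_ge s ε r
  have h2 := den_norm_ge' s ε r
  set D := ‖(r : ℂ) + zz s ε‖
  have h3 : |2 * ε * s| = 2 * ε * |s| := by rw [abs_mul, abs_of_pos (by positivity)]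
  rw [h3] at h2
  have h4 : r - 2 * |s| ≤ D := by
    have := le_abs_self (r + 2 * s)
    have := neg_abs_le s
    linarith
  have hs := abs_nonneg s
  have h5 : r + |s| ≤ (1 + 2 / ε) * D := by
    have : |s| ≤ D / (2 * ε) := by rw [le_div_iff₀ (by positivity)]; linarith
    have e : (1 + 2 / ε) * D = D + 4 * (D / (2 * ε)) := by field_simp; ring
    rw [e]; linarith
  have hD : 0 < D := by
    by_contra h
    have : (1 + 2 / ε) * D ≤ 0 := mul_nonpos_of_nonneg_of_nonpos (by positivity) (not_lt.mp h)
    linarith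
  rw [← div_eq_mul_inv, le_div_iff₀ (by linarith), inv_mul_le_iff₀ hD, mul_comm]
  linarith

lemma KK_integrable {k : EuclideanSpace ℝ (Fin 2)} (hk : k ≠ 0) (x : EuclideanSpace ℝ (Fin 2))
    {ε N : ℝ} (he : 0 < ε) (hN : 0 < N) :
    Integrable (KK k x ε) ((νr N).prod νt) := by
  have hmeas : Measurable (fun p : ℝ × ℝ => (1 + 2 / ε) * (p.1 + |cc k p.2|)⁻¹) := by
    have h1 := (cc_cont k).measurable
    fun_prop
  have hne : ∀ᵐ θ ∂νt, cc k θ ≠ 0 := ae_restrict_of_ae (cc_ae_ne hk)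
  have hint : ∀ c : ℝ, 0 < c → ∫ r in (0:ℝ)..N, (r + c)⁻¹ = Real.log (N + c) - Real.log c := by
    intro c hc
    rw [intervalIntegral.integral_comp_add_right (fun r => r⁻¹),
      integral_inv_of_pos (by linarith) (by linarith), Real.log_div (by linarith) (by linarith)]
    simp
  have hii : ∀ c : ℝ, 0 < c → IntervalIntegrable (fun r : ℝ => (r + c)⁻¹) volume 0 N := by
    intro c hc
    apply ContinuousOn.intervalIntegrable
    refine ContinuousOn.inv₀ (by fun_prop) ?_
    intro r hr
    rw [Set.uIcc_of_le hN.le] at hr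
    linarith [hr.1]
  have hdom : Integrable (fun p : ℝ × ℝ => (1 + 2 / ε) * (p.1 + |cc k p.2|)⁻¹)
      ((νr N).prod νt) := by
    rw [integrable_prod_iff' hmeas.aestronglyMeasurable]
    constructor
    · filter_upwards [hne] with θ hθ
      have := (hii _ (abs_pos.mpr hθ)).const_mul (1 + 2 / ε)
      rwa [intervalIntegrable_iff_integrableOn_Ioc_of_le hN.le] at this
    · have hb : Integrable (fun θ => (1 + 2 / ε) * ((|Real.log N| + |Real.log (N + ‖k‖)|)
          + |Real.log (|cc k θ|)|)) νt :=
        ((integrable_const _).add (cc_log_int k)).const_mul _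
      refine hb.mono' ?_ ?_
      · exact (hmeas.norm.comp measurable_swap).aestronglyMeasurable.integral_prod_right'
          (μ := νt) (ν := νr N)
      · filter_upwards [hne] with θ hθ
        have hc := abs_pos.mpr hθ
        have e1 : ∫ r, ‖(1 + 2 / ε) * (r + |cc k θ|)⁻¹‖ ∂νr N =
            (1 + 2 / ε) * (Real.log (N + |cc k θ|) - Real.log (|cc k θ|)) := by
          rw [← hint _ hc, ← intervalIntegral.integral_const_mul,
            intervalIntegral.integral_of_le hN.le]
          apply setIntegral_congr_fun measurableSet_Ioc
          intro r hr
          have := hr.1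
          simp only
          rw [Real.norm_eq_abs, abs_of_nonneg (by positivity)]
        rw [e1, norm_mul, Real.norm_eq_abs, abs_of_nonneg (by positivity)]
        refine mul_le_mul_of_nonneg_left ?_ (by positivity)
        refine (norm_sub_le _ _).trans ?_
        rw [Real.norm_eq_abs, Real.norm_eq_abs]
        gcongr
        apply abs_log_le_of_mem hN
        · linarith
        · linarith [cc_le k θ]
  refine hdom.mono' (KK_meas k x ε).aestronglyMeasurable ?_
  rw [prod_eq, Measure.restrict_restrict (mset N)]
  refine ae_restrict_of_forall_mem ((mset N).inter polarCoord.open_target.measurableSet) ?_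
  intro p hp
  exact Kf_le he hp.2.1

lemma integral_eq_J {k : EuclideanSpace ℝ (Fin 2)} (hk : k ≠ 0) (x : EuclideanSpace ℝ (Fin 2))
    {ε N : ℝ} (he : 0 < ε) (hN : 0 < N) :
    ∫ ξ in Metric.closedBall 0 N, gg k x ε ξ = ∫ θ, J (cc x θ) (cc k θ) ε N ∂νt := by
  rw [integral_transfer, integral_prod_symm _ (KK_integrable hk x he hN)]
  congr 1
  ext θ
  unfold J
  rw [intervalIntegral.integral_of_le hN.le]
  rfl

lemma J_meas (k x : EuclideanSpace ℝ (Fin 2)) (ε : ℝ) {N : ℝ} (hN : 0 < N) :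
    AEStronglyMeasurable (fun θ => J (cc x θ) (cc k θ) ε N) νt := by
  have := ((KK_meas k x ε).comp measurable_swap).aestronglyMeasurable.integral_prod_right'
          (μ := νt) (ν := νr N)
  refine this.congr (Eventually.of_forall fun θ => ?_)
  simp only [J]
  rw [intervalIntegral.integral_of_le hN.le]
  rfl

end ScatGreen

open ScatGreen in
/-- Let `k, x ∈ ℝ²`, `k ≠ 0`, `x ≠ 0`. Then for each `ε > 0` the function
`ξ ↦ e^{i x·ξ}(‖ξ‖² + 2 k·ξ + 2iε k·ξ)⁻¹` is Lebesgue integrable on each disc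
`{‖ξ‖ ≤ N}`, for each `N > 2|k|` the limit
`A_N := lim_{ε→0⁺} ∫_{‖ξ‖≤N} e^{i x·ξ}(‖ξ‖² + 2 k·ξ + 2iε k·ξ)⁻¹ dξ` exists in `ℂ`,
and `lim_{N→∞} A_N` exists in `ℂ`. -/
theorem scattering_green_function_exists
    (k x : EuclideanSpace ℝ (Fin 2)) (hk : k ≠ 0) (hx : x ≠ 0) :
    (∀ ε : ℝ, 0 < ε → ∀ N : ℝ,
      IntegrableOn
        (fun ξ : EuclideanSpace ℝ (Fin 2) =>
          Complex.exp (Complex.I * ((inner ℝ x ξ : ℝ) : ℂ)) *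
            (((‖ξ‖ ^ 2 + 2 * (inner ℝ k ξ : ℝ) : ℝ) : ℂ)
              + 2 * Complex.I * (ε : ℂ) * ((inner ℝ k ξ : ℝ) : ℂ))⁻¹)
        (Metric.closedBall 0 N)) ∧
    ∃ A : ℝ → ℂ,
      (∀ N : ℝ, 2 * ‖k‖ < N →
        Tendsto
          (fun ε : ℝ =>
            ∫ ξ in Metric.closedBall (0 : EuclideanSpace ℝ (Fin 2)) N,
              Complex.exp (Complex.I * ((inner ℝ x ξ : ℝ) : ℂ)) *
                (((‖ξ‖ ^ 2 + 2 * (inner ℝ k ξ : ℝ) : ℝ) : ℂ)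
                  + 2 * Complex.I * (ε : ℂ) * ((inner ℝ k ξ : ℝ) : ℂ))⁻¹)
          (𝓝[>] 0) (𝓝 (A N))) ∧
      ∃ L : ℂ, Tendsto A atTop (𝓝 L) := by
  have hkn : 0 ≤ ‖k‖ := norm_nonneg k
  have hkne : ∀ᵐ θ ∂νt, cc k θ ≠ 0 := ae_restrict_of_ae (cc_ae_ne hk)
  have hxne : ∀ᵐ θ ∂νt, cc x θ ≠ 0 := ae_restrict_of_ae (cc_ae_ne hx)
  refine ⟨?_, fun N => ∫ θ, J0 (cc x θ) (cc k θ) N ∂νt, ?_, ?_⟩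
  · intro ε he N
    have h := integrable_transfer k x ε (max N 1)
      (KK_integrable hk x he (lt_of_lt_of_le one_pos (le_max_right _ _)))
    exact h.mono_set (Metric.closedBall_subset_closedBall (le_max_left _ _))
  · intro N hN
    have hN0 : 0 < N := by linarith
    have h : Tendsto (fun ε => ∫ θ, J (cc x θ) (cc k θ) ε N ∂νt) (𝓝[>] 0)
        (𝓝 (∫ θ, J0 (cc x θ) (cc k θ) N ∂νt)) := by
      apply tendsto_integral_filter_of_dominated_convergence
        (fun θ => Cb ‖k‖ ‖x‖ N + 2 * |Real.log (|cc k θ|)|)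
      · exact Eventually.of_forall fun ε => J_meas k x ε hN0
      · have : Set.Ioc (0 : ℝ) 1 ∈ 𝓝[>] (0 : ℝ) := Ioc_mem_nhdsGT one_pos
        filter_upwards [this] with ε he
        filter_upwards [hkne] with θ hθ
        exact J_bound hθ he.1 he.2 hN (cc_le k θ) (cc_le x θ)
      · exact (integrable_const _).add ((cc_log_int k).const_mul 2)
      · filter_upwards [hkne] with θ hθ
        exact J0_tendsto hθ (by linarith [cc_le k θ])
    refine h.congr' ?_
    filter_upwards [self_mem_nhdsWithin] with ε he
    exact (integral_eq_J hk x he hN0).symm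
  · have hlim : ∀ θ, ∃ l, cc k θ ≠ 0 → cc x θ ≠ 0 →
        Tendsto (fun N => J0 (cc x θ) (cc k θ) N) atTop (𝓝 l) := by
      intro θ
      by_cases h1 : cc k θ = 0
      · exact ⟨0, fun h => absurd h1 h⟩
      · by_cases h2 : cc x θ = 0
        · exact ⟨0, fun _ h => absurd h2 h⟩
        · obtain ⟨l, hl⟩ := J0_lim (T := 4 * ‖k‖ + 1) h1 h2 (by linarith)
            (by linarith [cc_le k θ])
          exact ⟨l, fun _ _ => hl⟩
    choose l hl using hlim
    refine ⟨∫ θ, l θ ∂νt, ?_⟩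
    apply tendsto_integral_filter_of_dominated_convergence
      (fun θ => (Cb ‖k‖ ‖x‖ (4 * ‖k‖ + 1) + 4) + 2 * |Real.log (|cc k θ|)|
        + 2 * |Real.log (|cc x θ|)|)
    · filter_upwards [eventually_ge_atTop (4 * ‖k‖ + 1)] with N hN
      refine aestronglyMeasurable_of_tendsto_ae (𝓝[>] (0 : ℝ))
        (fun ε => J_meas k x ε (by linarith : 0 < N)) ?_
      filter_upwards [hkne] with θ hθ
      exact J0_tendsto hθ (by linarith [cc_le k θ])
    · filter_upwards [eventually_ge_atTop (4 * ‖k‖ + 1)] with N hN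
      filter_upwards [hkne, hxne] with θ h1 h2
      exact J0_unif h1 h2 (by linarith) (by linarith) hN (cc_le k θ) (cc_le x θ)
    · exact ((integrable_const _).add ((cc_log_int k).const_mul 2)).add
        ((cc_log_int x).const_mul 2)
    · filter_upwards [hkne, hxne] with θ h1 h2
      exact hl θ h1 h2
end
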